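/- arXiv:2503.01246 — 15 statements merged into one kernel-verified Lean document; each statement's English description precedes it below -/
import Mathlib

section
/- For every integer m ≥ 0, every real t ≠ 0 and every real s, the 2m-th derivative with respect to s of the function s ↦ 1/√(s² + t²) equals (Σ_{i=0}^{m} a_{2m,2i} s^{2i} t^{2(m−i)}) / (√(s² + t²))^{4m+1}. -/
open Finset

/-- The even-index coefficients `a_{2m,2i}`. -/
noncomputable def aEven (m i : ℕ) : ℝ :=
  (-1 : ℝ) ^ (m - i) * (2 : ℝ) ^ ((2 * (i : ℤ)) - 2 * (m : ℤ)) *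
    (Nat.factorial (2 * m) : ℝ) * (Nat.choose (2 * m) (m - i) : ℝ) *
    (Nat.choose (m + i) (m - i) : ℝ)

/-- The odd-index coefficients `a_{2m+1,2i+1}`. -/
noncomputable def aOdd (m i : ℕ) : ℝ :=
  (-1 : ℝ) ^ (m - i + 1) * (2 : ℝ) ^ ((2 * (i : ℤ)) - 2 * (m : ℤ)) *
    (Nat.factorial (2 * m + 1) : ℝ) * (Nat.choose (2 * m + 1) (m - i) : ℝ) *
    (Nat.choose (m + i + 1) (m - i) : ℝ)

/-- auxiliary coefficients -/
noncomputable def cAux (n k : ℕ) : ℝ :=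
  (-1 : ℝ) ^ (n + k) * ((4 : ℝ) ^ k)⁻¹ * (Nat.factorial n : ℝ) * (Nat.choose n (2 * k) : ℝ) *
    (Nat.centralBinom k : ℝ)

lemma cAux_zero_of_lt {n k : ℕ} (h : n < 2 * k) : cAux n k = 0 := by
  simp [cAux, Nat.choose_eq_zero_of_lt h]

lemma cAux_succ_zero (n : ℕ) : cAux (n + 1) 0 = -((n : ℝ) + 1) * cAux n 0 := by
  simp [cAux, Nat.factorial_succ, pow_succ]
  ring

lemma cAux_succ_succ (n k : ℕ) :
    cAux (n + 1) (k + 1) = -((n : ℝ) + 1 + 2 * (k + 1)) * cAux n (k + 1)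
      + ((n : ℝ) - 2 * k) * cAux n k := by
  have h1 : ((n : ℝ) - 2 * k) * (n.choose (2 * k) : ℝ)
      = (2 * k + 1) * (n.choose (2 * k + 1) : ℝ) := by
    rcases lt_or_ge n (2 * k) with h | h
    · rw [Nat.choose_eq_zero_of_lt h, Nat.choose_eq_zero_of_lt (by omega)]; simp
    · have := Nat.choose_succ_right_eq n (2 * k)
      have h' : ((n.choose (2 * k + 1) * (2 * k + 1) : ℕ) : ℝ)
        = ((n.choose (2 * k) * (n - 2 * k) : ℕ) : ℝ) := by rw [this]
      push_cast [Nat.cast_sub h] at h'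
      linarith
  have h2 : ((k : ℝ) + 1) * (Nat.centralBinom (k + 1) : ℝ)
      = 2 * (2 * k + 1) * (Nat.centralBinom k : ℝ) := by
    exact_mod_cast Nat.succ_mul_centralBinom_succ k
  have h3 : ((n : ℝ) + 1) * (n.choose (2 * k + 1) : ℝ)
      = ((n.choose (2 * k + 1) : ℝ) + (n.choose (2 * k + 2) : ℝ)) * (2 * k + 2) := by
    have := Nat.add_one_mul_choose_eq n (2 * k + 1)
    rw [Nat.choose_succ_succ] at this
    exact_mod_cast this
  have h4 : (((n + 1).choose (2 * (k + 1)) : ℕ) : ℝ)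
      = (n.choose (2 * k + 1) : ℝ) + (n.choose (2 * k + 2) : ℝ) := by
    have : (n + 1).choose (2 * (k + 1)) = n.choose (2 * k + 1) + n.choose (2 * k + 2) :=
      Nat.choose_succ_succ n (2 * k + 1)
    exact_mod_cast this
  unfold cAux
  rw [h4, Nat.factorial_succ, show 2 * (k + 1) = 2 * k + 2 by ring]
  push_cast
  have e : ((4 : ℝ) ^ (k + 1))⁻¹ = ((4 : ℝ) ^ k)⁻¹ / 4 := by
    rw [pow_succ, mul_inv]; ring
  rw [e, show n + 1 + (k + 1) = n + k + 2 by ring, show n + (k + 1) = n + k + 1 by ring,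
    pow_add _ (n + k) 2, pow_succ _ (n + k)]
  generalize (n.choose (2 * k) : ℝ) = x0 at *
  generalize (n.choose (2 * k + 1) : ℝ) = x1 at *
  generalize (n.choose (2 * k + 2) : ℝ) = x2 at *
  generalize (Nat.centralBinom (k + 1) : ℝ) = b1 at *
  generalize (Nat.centralBinom k : ℝ) = b0 at *
  clear e
  generalize (-1 : ℝ) ^ (n + k) = e at *
  generalize ((4 : ℝ) ^ k)⁻¹ = f at *
  generalize (Nat.factorial n : ℝ) = g at *
  linear_combination (e * f * g * b1 / 4) * h3 - (e * f * g * b0) * h1 + (e * f * g * x1 / 2) * h2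

/-- numerator polynomial -/
noncomputable def PAux (t : ℝ) (n : ℕ) (s : ℝ) : ℝ :=
  ∑ k ∈ Finset.range (n + 1), cAux n k * s ^ (n - 2 * k) * t ^ (2 * k)

/-- its derivative -/
noncomputable def QAux (t : ℝ) (n : ℕ) (s : ℝ) : ℝ :=
  ∑ k ∈ Finset.range (n + 1),
    cAux n k * (((n - 2 * k : ℕ) : ℝ) * s ^ (n - 2 * k - 1)) * t ^ (2 * k)

lemma PAux_hasDerivAt (t : ℝ) (n : ℕ) (s : ℝ) : HasDerivAt (PAux t n) (QAux t n s) s := by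
  unfold PAux QAux
  apply HasDerivAt.fun_sum
  intro k _
  exact ((hasDerivAt_pow (n - 2 * k) s).const_mul _).mul_const _

lemma PAux_succ (t : ℝ) (n : ℕ) (s : ℝ) :
    PAux t (n + 1) s = (s ^ 2 + t ^ 2) * QAux t n s - (2 * n + 1) * s * PAux t n s := by
  have hA : ∑ k ∈ Finset.range (n + 1),
        (-((n : ℝ) + 1 + 2 * k) * cAux n k) * s ^ (n + 1 - 2 * k) * t ^ (2 * k)
      = ∑ k ∈ Finset.range (n + 1 + 1),
        (-((n : ℝ) + 1 + 2 * k) * cAux n k) * s ^ (n + 1 - 2 * k) * t ^ (2 * k) := by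
    rw [Finset.sum_range_succ _ (n + 1), cAux_zero_of_lt (show n < 2 * (n + 1) by omega)]
    simp
  have hP : PAux t (n + 1) s = ∑ k ∈ Finset.range (n + 1),
        (-((n : ℝ) + 1 + 2 * k) * cAux n k) * s ^ (n + 1 - 2 * k) * t ^ (2 * k)
      + ∑ k ∈ Finset.range (n + 1),
        (((n : ℝ) - 2 * k) * cAux n k) * s ^ (n + 1 - 2 * (k + 1)) * t ^ (2 * (k + 1)) := by
    rw [hA]
    unfold PAux
    rw [Finset.sum_range_succ', Finset.sum_range_succ' _ (n + 1), cAux_succ_zero,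
      add_right_comm, ← Finset.sum_add_distrib]
    congr 1
    · apply Finset.sum_congr rfl
      intro k _
      rw [cAux_succ_succ]
      push_cast
      ring
    · simp
  rw [hP]
  unfold PAux QAux
  rw [Finset.mul_sum, Finset.mul_sum, ← Finset.sum_sub_distrib, ← Finset.sum_add_distrib]
  apply Finset.sum_congr rfl
  intro k _
  rcases lt_or_ge n (2 * k) with h | h
  · rw [cAux_zero_of_lt h]; ring
  · obtain ⟨j, rfl⟩ := Nat.exists_eq_add_of_le h
    rw [show 2 * k + j + 1 - 2 * k = j + 1 by omega, show 2 * k + j - 2 * k = j by omega,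
      show 2 * k + j + 1 - 2 * (k + 1) = j - 1 by omega]
    push_cast
    rcases j with _ | j
    · simp; ring
    · simp only [Nat.add_sub_cancel]; push_cast; ring

lemma iter_aux (t : ℝ) (ht : t ≠ 0) (n : ℕ) :
    iteratedDeriv n (fun s : ℝ => 1 / Real.sqrt (s ^ 2 + t ^ 2)) =
      fun s => PAux t n s / (Real.sqrt (s ^ 2 + t ^ 2)) ^ (2 * n + 1) := by
  induction n with
  | zero => 
    funext s
    simp [PAux, cAux]
  | succ n ih =>
    rw [iteratedDeriv_succ, ih]
    funext s
    have hpos : 0 < s ^ 2 + t ^ 2 := by positivity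
    have hr : 0 < Real.sqrt (s ^ 2 + t ^ 2) := Real.sqrt_pos.2 hpos
    have h0 : HasDerivAt (fun s : ℝ => s ^ 2 + t ^ 2) (2 * s) s := by
      simpa using (hasDerivAt_pow 2 s).add_const (t ^ 2)
    have h1 := (h0.sqrt hpos.ne').fun_pow (2 * n + 1)
    have h2 := (PAux_hasDerivAt t n s).fun_div h1 (pow_pos hr _).ne'
    rw [h2.deriv, PAux_succ]
    have hsq : s ^ 2 + t ^ 2 = Real.sqrt (s ^ 2 + t ^ 2) ^ 2 := (Real.sq_sqrt hpos.le).symm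
    have e : ∀ r q p : ℝ, 0 < r →
      (q * r ^ (2 * n + 1) - p * (((2 * n + 1 : ℕ) : ℝ) * r ^ (2 * n + 1 - 1) * (2 * s / (2 * r))))
        / (r ^ (2 * n + 1)) ^ 2 = (r ^ 2 * q - (2 * n + 1) * s * p) / r ^ (2 * (n + 1) + 1) := by
      intro r q p hr
      simp only [Nat.add_sub_cancel]
      push_cast
      rw [div_eq_div_iff (by positivity) (by positivity)]
      field_simp
      ring
    rw [e _ _ _ hr, ← hsq]

lemma cAux_even (m i : ℕ) (h : i ≤ m) : cAux (2 * m) (m - i) = aEven m i := by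
  obtain ⟨k, rfl⟩ := Nat.exists_eq_add_of_le h
  unfold cAux aEven
  rw [show i + k - i = k by omega, show i + k + i = 2 * i + k by omega]
  have h1 : ((2 : ℝ) ^ ((2 * (i : ℤ)) - 2 * ((i + k : ℕ) : ℤ))) = ((4 : ℝ) ^ k)⁻¹ := by
    rw [show (2 * (i : ℤ)) - 2 * ((i + k : ℕ) : ℤ) = -((2 * k : ℕ) : ℤ) by push_cast; ring,
      zpow_neg, zpow_natCast, pow_mul]
    norm_num
  have h2 : (2 * (i + k)).choose (2 * k) * Nat.centralBinom k
      = (2 * (i + k)).choose k * (2 * i + k).choose k := by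
    rw [Nat.centralBinom, Nat.choose_mul (by omega)]
    congr 2 <;> omega
  have h2' : ((2 * (i + k)).choose (2 * k) : ℝ) * (Nat.centralBinom k : ℝ)
      = ((2 * (i + k)).choose k : ℝ) * ((2 * i + k).choose k : ℝ) := by exact_mod_cast h2
  rw [h1, pow_add, pow_mul]
  norm_num
  rw [mul_assoc, h2', ← mul_assoc]

theorem iteratedDeriv_even_inv_sqrt (m : ℕ) (t : ℝ) (ht : t ≠ 0) (s : ℝ) :
    iteratedDeriv (2 * m) (fun s : ℝ => 1 / Real.sqrt (s ^ 2 + t ^ 2)) s =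
      (∑ i ∈ Finset.range (m + 1), aEven m i * s ^ (2 * i) * t ^ (2 * (m - i))) /
        (Real.sqrt (s ^ 2 + t ^ 2)) ^ (4 * m + 1) := by
  rw [iter_aux t ht]
  have h : PAux t (2 * m) s
      = ∑ i ∈ Finset.range (m + 1), aEven m i * s ^ (2 * i) * t ^ (2 * (m - i)) := by
    unfold PAux
    rw [← Finset.sum_subset (Finset.range_subset_range.2 (show m + 1 ≤ 2 * m + 1 by omega)),
      ← Finset.sum_range_reflect]
    · apply Finset.sum_congr rfl
      intro i hi
      have hi' : i ≤ m := by simpa [Nat.lt_succ_iff] using hi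
      rw [show m + 1 - 1 - i = m - i by omega, cAux_even m i hi',
        show 2 * m - 2 * (m - i) = 2 * i by omega]
    · intro k _ hk
      rw [cAux_zero_of_lt (by simp at hk; omega)]
      ring
  simp only [h]
  rw [show 2 * (2 * m) + 1 = 4 * m + 1 by ring]
end

section
/- For every integer m ≥ 0, every real t ≠ 0 and every real s, the (2m+1)-th derivative with respect to s of the function s ↦ 1/√(s² + t²) equals (Σ_{i=0}^{m} a_{2m+1,2i+1} s^{2i+1} t^{2(m−i)}) / (√(s² + t²))^{4m+3}. -/
open Finset

noncomputable def cc (n k : ℕ) : ℝ :=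
  if 2 * k ≤ n then (-1/4 : ℝ) ^ k * (n.factorial : ℝ) /
    ((k.factorial : ℝ) ^ 2 * ((n - 2 * k).factorial : ℝ)) else 0

lemma cc_zero {n k : ℕ} (h : n < 2 * k) : cc n k = 0 := by
  rw [cc, if_neg (by omega)]

lemma cc_add (k j : ℕ) : cc (2 * k + j) k = (-1/4 : ℝ) ^ k * ((2 * k + j).factorial : ℝ) /
    ((k.factorial : ℝ) ^ 2 * (j.factorial : ℝ)) := by
  rw [cc, if_pos (by omega), Nat.add_sub_cancel_left]

noncomputable def TT (t s : ℝ) (n k : ℕ) : ℝ := cc n k * s ^ (n - 2 * k) * t ^ (2 * k)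

noncomputable def TD (t s : ℝ) (n k : ℕ) : ℝ :=
  cc n k * (((n - 2 * k : ℕ) : ℝ) * s ^ (n - 2 * k - 1)) * t ^ (2 * k)

lemma TT_deriv (t s : ℝ) (n k : ℕ) : HasDerivAt (fun s => TT t s n k) (TD t s n k) s := by
  unfold TT TD
  exact ((hasDerivAt_pow _ s).const_mul _).mul_const _

lemma s_TD (t s : ℝ) (n k : ℕ) : s * TD t s n k = ((n : ℝ) - 2 * k) * TT t s n k := by
  unfold TT TD
  rcases lt_or_ge n (2 * k) with h | h
  · simp [cc_zero h]
  · obtain ⟨j, rfl⟩ := Nat.exists_eq_add_of_le h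
    rw [Nat.add_sub_cancel_left]
    rcases j with _ | j
    · simp
    · simp only [Nat.add_sub_cancel]
      push_cast
      ring

lemma rec_zero (t s : ℝ) (n : ℕ) : ((n : ℝ) + 1) * TT t s (n + 1) 0 =
    ((n : ℝ) + 1) * (s * TT t s n 0) := by
  have h (n : ℕ) : cc n 0 = 1 := by
    have : (n.factorial : ℝ) ≠ 0 := by positivity
    simp [cc, this]
  simp only [TT, h, mul_zero, Nat.sub_zero]
  ring

lemma rec_succ (t s : ℝ) (n k : ℕ) : ((n : ℝ) + 1) * TT t s (n + 1) (k + 1) =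
    ((n : ℝ) + 1 + 2 * (k + 1)) * (s * TT t s n (k + 1)) - t ^ 2 * TD t s n k := by
  unfold TT TD
  rcases lt_or_ge n (2 * k) with h | h
  · simp [cc_zero h, cc_zero (show n + 1 < 2 * (k + 1) by omega),
      cc_zero (show n < 2 * (k + 1) by omega)]
  · obtain ⟨j, rfl⟩ := Nat.exists_eq_add_of_le h
    rcases j with _ | _ | j
    · simp [cc_zero (show 2 * k + 0 + 1 < 2 * (k + 1) by omega),
        cc_zero (show 2 * k < 2 * (k + 1) by omega)]
    · rw [cc_zero (show 2 * k + (0 + 1) < 2 * (k + 1) by omega)]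
      have e : 2 * k + (0 + 1) + 1 = 2 * (k + 1) + 0 := by ring
      rw [e, cc_add, cc_add]
      have h1 : (k.factorial : ℝ) ≠ 0 := by positivity
      have e2 : 2 * (k + 1) + 0 = (2 * k + 1) + 1 := by ring
      simp only [e2, Nat.factorial_succ, zero_add, Nat.add_sub_cancel_left]
      have e3 : 2 * k + 1 + 1 - 2 * (k + 1) = 0 := by omega
      simp only [e3]
      push_cast
      field_simp
      simp
      ring
    · have e : 2 * k + (j + 1 + 1) + 1 = 2 * (k + 1) + (j + 1) := by ring
      have e' : cc (2 * k + (j + 1 + 1)) (k + 1) = cc (2 * (k + 1) + j) (k + 1) := by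
        congr 1; ring
      rw [e, e', cc_add, cc_add, cc_add]
      have e2 : 2 * k + (j + 1 + 1) - 2 * (k + 1) = j := by omega
      have e3 : 2 * (k + 1) + (j + 1) = (2 * k + j + 2) + 1 := by ring
      have e4 : 2 * (k + 1) + j = 2 * k + j + 2 := by ring
      have e5 : 2 * k + (j + 1 + 1) = 2 * k + j + 2 := by ring
      have e6 : 2 * k + j + 2 + 1 - 2 * (k + 1) = j + 1 := by omega
      have e7 : 2 * k + j + 2 - 2 * (k + 1) = j := by omega
      have e8 : 2 * k + j + 2 - 2 * k = j + 2 := by omega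
      have e9 : j + 2 - 1 = j + 1 := by omega
      rw [e3, e4, e5, e6, e7, e8, e9, Nat.factorial_succ (2 * k + j + 2), Nat.factorial_succ (j + 1),
        Nat.factorial_succ j, Nat.factorial_succ k]
      generalize (2 * k + j + 2).factorial = F
      have h1 : (k.factorial : ℝ) ≠ 0 := by positivity
      have h2 : (j.factorial : ℝ) ≠ 0 := by positivity
      push_cast
      field_simp
      ring

lemma rec_sum (t s : ℝ) (n M : ℕ) (h : n + 1 < 2 * (M + 1)) :
    ((n : ℝ) + 1) * ∑ k ∈ range (M + 1), TT t s (n + 1) k =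
    (2 * (n : ℝ) + 1) * s * ∑ k ∈ range (M + 1), TT t s n k
      - (s ^ 2 + t ^ 2) * ∑ k ∈ range (M + 1), TD t s n k := by
  have hz : TD t s n M = 0 := by
    have : n - 2 * M = 0 := by omega
    simp [TD, this]
  have h1 : ∑ k ∈ range (M + 1), ((n : ℝ) + 1) * TT t s (n + 1) k =
      ∑ k ∈ range (M + 1), ((n : ℝ) + 1 + 2 * k) * (s * TT t s n k)
        - ∑ k ∈ range M, t ^ 2 * TD t s n k := by
    rw [sum_range_succ', sum_range_succ' _ M, rec_zero]
    simp only [rec_succ, sum_sub_distrib]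
    push_cast
    ring
  have h2 : ∑ k ∈ range (M + 1), ((n : ℝ) + 1 + 2 * k) * (s * TT t s n k) =
      (2 * (n : ℝ) + 1) * s * ∑ k ∈ range (M + 1), TT t s n k
      - s ^ 2 * ∑ k ∈ range (M + 1), TD t s n k := by
    rw [mul_sum, mul_sum, ← sum_sub_distrib]
    refine sum_congr rfl fun k _ => ?_
    linear_combination s * s_TD t s n k
  have h3 : ∑ k ∈ range M, t ^ 2 * TD t s n k = t ^ 2 * ∑ k ∈ range (M + 1), TD t s n k := by
    rw [sum_range_succ, hz, add_zero, mul_sum]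
  rw [mul_sum, h1, h2, h3]
  ring

lemma main_formula (t : ℝ) (ht : t ≠ 0) (N n : ℕ) (h : n < 2 * N) :
    iteratedDeriv n (fun s : ℝ => 1 / Real.sqrt (s ^ 2 + t ^ 2)) =
      fun s => (-1) ^ n * (n.factorial : ℝ) * (∑ k ∈ range N, TT t s n k) /
        (Real.sqrt (s ^ 2 + t ^ 2)) ^ (2 * n + 1) := by
  obtain ⟨M, rfl⟩ : ∃ M, N = M + 1 := ⟨N - 1, by omega⟩
  induction n with
  | zero =>
    funext s
    have : ∑ k ∈ range (M + 1), TT t s 0 k = 1 := by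
      rw [sum_range_succ', sum_eq_zero]
      · simp [TT, cc]
      · intro k _
        simp [TT, cc_zero (show 0 < 2 * (k + 1) by omega)]
    simp [this]
  | succ n ih =>
    rw [iteratedDeriv_succ, ih (by omega)]
    funext s
    have hp : 0 < s ^ 2 + t ^ 2 := by positivity
    have hr : 0 < Real.sqrt (s ^ 2 + t ^ 2) := Real.sqrt_pos.mpr hp
    have hsq : Real.sqrt (s ^ 2 + t ^ 2) ^ 2 = s ^ 2 + t ^ 2 := Real.sq_sqrt hp.le
    have d0 : HasDerivAt (fun s : ℝ => s ^ 2 + t ^ 2) (2 * s) s := by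
      simpa using (hasDerivAt_pow 2 s).add_const (t ^ 2)
    have d1 := (d0.sqrt hp.ne').pow (2 * n + 1)
    have d2 : HasDerivAt (fun s => ∑ k ∈ range (M + 1), TT t s n k)
        (∑ k ∈ range (M + 1), TD t s n k) s :=
      HasDerivAt.fun_sum fun k _ => TT_deriv t s n k
    have d3 := (d2.const_mul ((-1) ^ n * (n.factorial : ℝ))).div d1 (pow_pos hr _).ne'
    have key := rec_sum t s n M h
    refine d3.deriv.trans ?_
    rw [← hsq] at key
    try simp only [Pi.pow_apply]
    generalize Real.sqrt (s ^ 2 + t ^ 2) = r at *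
    rw [Nat.factorial_succ]
    push_cast
    try simp only [Nat.add_sub_cancel]
    have hr' := hr.ne'
    generalize ∑ k ∈ range (M + 1), TT t s (n + 1) k = A at *
    generalize ∑ k ∈ range (M + 1), TT t s n k = B at *
    generalize ∑ k ∈ range (M + 1), TD t s n k = C at *
    have : (-1 : ℝ) ^ (n + 1) * (((n : ℝ) + 1) * n.factorial) * A =
      (-1) ^ (n + 1) * n.factorial * ((2 * n + 1) * s * B - r ^ 2 * C) := by
      rw [← key]; ring
    rw [this]
    field_simp
    ring

lemma coef (m k : ℕ) (hk : k ≤ m) :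
    (-1) ^ (2 * m + 1) * ((2 * m + 1).factorial : ℝ) * cc (2 * m + 1) k = aOdd m (m - k) := by
  obtain ⟨i, rfl⟩ := Nat.exists_eq_add_of_le hk
  have e1 : k + i - (k + i - k) = k := by omega
  have e2 : k + i - k = i := by omega
  unfold aOdd
  rw [e1, e2, show k + i + i + 1 = k + (2 * i + 1) by ring,
    show 2 * (k + i) + 1 = 2 * k + (2 * i + 1) by ring, cc_add,
    Nat.cast_choose ℝ (show k ≤ 2 * k + (2 * i + 1) by omega),
    Nat.cast_choose ℝ (show k ≤ k + (2 * i + 1) by omega),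
    show 2 * k + (2 * i + 1) - k = k + (2 * i + 1) by omega, Nat.add_sub_cancel_left,
    show (2 * (i : ℤ) - 2 * ((k + i : ℕ) : ℤ)) = -((2 * k : ℕ) : ℤ) by push_cast; ring,
    zpow_neg, zpow_natCast, pow_mul, div_pow, ← pow_mul, pow_add (-1 : ℝ) (2 * k), pow_mul, pow_succ (-1 : ℝ) (2 * i), pow_mul (-1 : ℝ) 2 i]
  have h1 : (k.factorial : ℝ) ≠ 0 := by positivity
  have h2 : ((2 * i + 1).factorial : ℝ) ≠ 0 := by positivity
  have h3 : ((k + (2 * i + 1)).factorial : ℝ) ≠ 0 := by positivity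
  generalize ((2 * k + (2 * i + 1)).factorial : ℝ) = F
  rw [show (4 : ℝ) = 2 ^ 2 by norm_num]
  field_simp
  norm_num
  ring_nf
  rw [show (2 : ℝ) ^ (k * 2) = 4 ^ k by rw [mul_comm, pow_mul]; norm_num]

theorem iteratedDeriv_odd_inv_sqrt (m : ℕ) (t : ℝ) (ht : t ≠ 0) (s : ℝ) :
    iteratedDeriv (2 * m + 1) (fun s : ℝ => 1 / Real.sqrt (s ^ 2 + t ^ 2)) s =
      (∑ i ∈ Finset.range (m + 1), aOdd m i * s ^ (2 * i + 1) * t ^ (2 * (m - i))) /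
        (Real.sqrt (s ^ 2 + t ^ 2)) ^ (4 * m + 3) := by
  rw [main_formula t ht (m + 1) (2 * m + 1) (by omega)]
  simp only
  rw [show 2 * (2 * m + 1) + 1 = 4 * m + 3 by ring]
  congr 1
  rw [mul_sum, ← sum_range_reflect (fun i => aOdd m i * s ^ (2 * i + 1) * t ^ (2 * (m - i)))]
  refine sum_congr rfl fun k hk => ?_
  have hk' : k ≤ m := by have := mem_range.mp hk; omega
  rw [show m + 1 - 1 - k = m - k by omega, ← coef m k hk', TT,
    show m - (m - k) = k by omega, show 2 * m + 1 - 2 * k = 2 * (m - k) + 1 by omega]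
  ring
end

section
/- For every integer m ≥ 1, Σ_{i=0}^{m} a_{2m,2i} / C(2m−1, m−i) = (2m)! / 2^{2m−1}. -/
open Finset

lemma fibSum (n : ℕ) :
    ∑ j ∈ range (n + 1), ((n - j).choose j : ℝ) * (-1 / 4) ^ j = (n + 1) / 2 ^ n := by
  induction n using Nat.twoStepInduction with
  | zero => norm_num
  | one => norm_num [sum_range_succ]
  | more n h0 h1 =>
    rw [sum_range_succ'] at h1
    rw [sum_range_succ', sum_range_succ]
    have key : ∀ k ∈ range (n + 1),
        ((n + 2 - (k + 1)).choose (k + 1) : ℝ) * (-1 / 4) ^ (k + 1) =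
        (-1 / 4) * (((n - k).choose k : ℝ) * (-1 / 4) ^ k) +
        ((n + 1 - (k + 1)).choose (k + 1) : ℝ) * (-1 / 4) ^ (k + 1) := by
      intro k hk
      have hk' : k < n + 1 := mem_range.mp hk
      rw [show n + 2 - (k + 1) = (n - k) + 1 by omega, show n + 1 - (k + 1) = n - k by omega,
        Nat.choose_succ_succ]
      push_cast
      ring
    rw [sum_congr rfl key, sum_add_distrib, ← mul_sum, h0]
    have h2 := eq_sub_of_add_eq h1
    rw [h2, show n + 2 - (n + 1 + 1) = 0 by omega]
    simp
    field_simp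
    ring

lemma fibSumEven (p : ℕ) :
    ∑ j ∈ range (p + 1), ((2 * p - j).choose j : ℝ) * (-1 / 4) ^ j = (2 * p + 1) / 4 ^ p := by
  have h := fibSum (2 * p)
  rw [pow_mul] at h
  norm_num at h
  norm_num
  rw [← h]
  apply sum_subset
  · intro x; simp only [mem_range]; omega
  · intro x _ hx
    simp only [mem_range] at hx
    rw [Nat.choose_eq_zero_of_lt (by omega)]
    simp

lemma term_eq (p k : ℕ) (hk : k ≤ p) :
    ((2 * p + 2).choose (k + 1) : ℝ) * ((2 * p + 1 - k).choose (k + 1) : ℝ) /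
      ((2 * p + 1).choose (k + 1) : ℝ) =
    ((2 * p + 1 - k).choose (k + 1) : ℝ) + ((2 * p - k).choose k : ℝ) := by
  have h1 := Nat.choose_mul_succ_eq (2 * p + 1) (k + 1)
  have h2 := Nat.add_one_mul_choose_eq (2 * p - k) k
  have h3 : 0 < (2 * p + 1).choose (k + 1) := Nat.choose_pos (by omega)
  obtain ⟨q, hq⟩ : ∃ q, 2 * p = k + q := ⟨2 * p - k, by omega⟩
  rw [show 2 * p + 1 + 1 - (k + 1) = q + 1 by omega] at h1
  rw [show 2 * p - k = q by omega] at h2 ⊢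
  rw [show 2 * p + 1 - k = q + 1 by omega]
  have h3' : ((2 * p + 1).choose (k + 1) : ℝ) ≠ 0 := by exact_mod_cast h3.ne'
  have h1' : ((2 * p + 1).choose (k + 1) : ℝ) * (2 * p + 1 + 1) =
      ((2 * p + 2).choose (k + 1) : ℝ) * (q + 1) := by exact_mod_cast h1
  have h2' : ((q : ℝ) + 1) * (q.choose k : ℝ) = ((q + 1).choose (k + 1) : ℝ) * (k + 1) := by
    exact_mod_cast h2
  have hq' : (2 * p : ℝ) = k + q := by exact_mod_cast hq
  have hq0 : (q : ℝ) + 1 ≠ 0 := by positivity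
  rw [div_eq_iff h3']
  apply mul_left_cancel₀ hq0
  rw [hq'] at h1'
  linear_combination (-((q + 1).choose (k + 1) : ℝ)) * h1' - ((2 * p + 1).choose (k + 1) : ℝ) * h2'

theorem sum_aEven_div_choose_pred (m : ℕ) (hm : 1 ≤ m) :
    ∑ i ∈ Finset.range (m + 1), aEven m i / (Nat.choose (2 * m - 1) (m - i) : ℝ) =
      (Nat.factorial (2 * m) : ℝ) / 2 ^ (2 * m - 1) := by
  obtain ⟨p, rfl⟩ : ∃ p, m = p + 1 := ⟨m - 1, by omega⟩
  rw [← sum_flip]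
  have key : ∀ j ∈ range (p + 1 + 1),
      aEven (p + 1) (p + 1 - j) / (Nat.choose (2 * (p + 1) - 1) (p + 1 - (p + 1 - j)) : ℝ) =
      (Nat.factorial (2 * (p + 1)) : ℝ) * ((-1 / 4) ^ j *
       (((2 * (p + 1)).choose j : ℝ) * ((2 * (p + 1) - j).choose j : ℝ) /
        ((2 * p + 1).choose j : ℝ))) := by
    intro j hj
    have hj' : j < p + 1 + 1 := mem_range.mp hj
    unfold aEven
    rw [show p + 1 - (p + 1 - j) = j by omega, show p + 1 + (p + 1 - j) = 2 * (p + 1) - j by omega,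
      show 2 * (p + 1) - 1 = 2 * p + 1 by omega,
      show (2 * ((p + 1 - j : ℕ) : ℤ) - 2 * ((p + 1 : ℕ) : ℤ)) = -((2 * j : ℕ) : ℤ) by omega,
      zpow_neg, zpow_natCast, pow_mul, div_pow]
    norm_num
    ring
  rw [sum_congr rfl key, ← mul_sum, div_eq_mul_inv (Nat.factorial _ : ℝ)]
  congr 1
  have hA := fibSumEven (p + 1)
  have hB := fibSumEven p
  rw [sum_range_succ'] at hA ⊢
  have key2 : ∀ k ∈ range (p + 1), ((-1 / 4 : ℝ) ^ (k + 1) *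
       (((2 * (p + 1)).choose (k + 1) : ℝ) * ((2 * (p + 1) - (k + 1)).choose (k + 1) : ℝ) /
        ((2 * p + 1).choose (k + 1) : ℝ))) =
      ((2 * (p + 1) - (k + 1)).choose (k + 1) : ℝ) * (-1 / 4) ^ (k + 1) +
      (-1 / 4) * (((2 * p - k).choose k : ℝ) * (-1 / 4) ^ k) := by
    intro k hk
    have hk' : k < p + 1 := mem_range.mp hk
    have := term_eq p k (by omega)
    rw [show 2 * (p + 1) - (k + 1) = 2 * p + 1 - k by omega, show 2 * (p + 1) = 2 * p + 2 by ring,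
      this]
    ring
  rw [sum_congr rfl key2, sum_add_distrib, ← mul_sum, hB, eq_sub_of_add_eq hA,
    show 2 * (p + 1) - 1 = 2 * p + 1 by omega, pow_succ 2 (2 * p), pow_mul]
  simp
  norm_num
  field_simp
  ring
end

section
/- For every integer m ≥ 1, Σ_{i=0}^{m} a_{2m+1,2i+1} / C(2m, m−i) = −(2m+1)! / 2^{2m}. -/
open Finset

theorem F_rec (n : ℕ) (x : ℝ) :
    ∑ p ∈ antidiagonal (n+2), (Nat.choose p.2 p.1 : ℝ) * x ^ p.1 =
    ∑ p ∈ antidiagonal (n+1), (Nat.choose p.2 p.1 : ℝ) * x ^ p.1 +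
    x * ∑ p ∈ antidiagonal n, (Nat.choose p.2 p.1 : ℝ) * x ^ p.1 := by
  rw [Finset.Nat.antidiagonal_succ_succ', Finset.Nat.antidiagonal_succ]
  simp only [Finset.sum_cons, Finset.sum_map, Finset.mul_sum]
  simp [Nat.choose_succ_succ, add_mul, Finset.sum_add_distrib, pow_succ]
  rw [add_assoc, add_right_inj, add_comm, add_right_inj]
  exact Finset.sum_congr rfl fun p _ => by ring

theorem F_val (n : ℕ) :
    ∑ p ∈ antidiagonal n, (Nat.choose p.2 p.1 : ℝ) * (-1/4 : ℝ) ^ p.1 = (n+1) / 2 ^ n := by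
  induction n using Nat.twoStepInduction with
  | zero => simp
  | one => simp [Finset.Nat.antidiagonal_succ]
  | more n h1 h2 =>
    rw [F_rec, h1, h2]
    push_cast
    field_simp
    ring

theorem F_range (n m : ℕ) (h1 : n ≤ 2 * m + 1) (h2 : m ≤ n) :
    ∑ j ∈ range (m+1), (Nat.choose (n - j) j : ℝ) * (-1/4 : ℝ) ^ j = (n+1) / 2 ^ n := by
  rw [← F_val, Finset.Nat.sum_antidiagonal_eq_sum_range_succ_mk]
  refine Finset.sum_subset (by intro j; simp; omega) ?_
  intro j hj hj'
  simp at hj hj'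
  rw [Nat.choose_eq_zero_of_lt (by omega)]
  simp

theorem term_eq_s3 (m j : ℕ) (hj : j ≤ m) :
    (Nat.choose (2*m+1) j : ℝ) * (Nat.choose (2*m+1-j) j : ℝ) / (Nat.choose (2*m) j : ℝ)
      = 2 * (Nat.choose (2*m+1-j) j : ℝ) - (Nat.choose (2*m-j) j : ℝ) := by
  obtain ⟨k, rfl⟩ := Nat.exists_eq_add_of_le hj
  have e1 : 2*(j+k)+1-j = j+2*k+1 := by omega
  have e2 : 2*(j+k)-j = j+2*k := by omega
  rw [e1, e2]
  have h0 : (Nat.choose (2*(j+k)) j : ℝ) ≠ 0 := by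
    exact_mod_cast (Nat.choose_pos (by omega)).ne'
  have h1 := Nat.choose_mul_succ_eq (2*(j+k)) j
  have h2 := Nat.choose_mul_succ_eq (j+2*k) j
  rw [e1] at h1
  rw [show j+2*k+1-j = 2*k+1 by omega] at h2
  have h1' : (Nat.choose (2*(j+k)) j : ℝ) * (2*(j+k)+1) = Nat.choose (2*(j+k)+1) j * (j+2*k+1) := by
    exact_mod_cast h1
  have h2' : (Nat.choose (j+2*k) j : ℝ) * (j+2*k+1) = Nat.choose (j+2*k+1) j * (2*k+1) := by
    exact_mod_cast h2
  have h3 : (j+2*k+1 : ℝ) ≠ 0 := by positivity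
  rw [div_eq_iff h0]
  apply mul_right_cancel₀ h3
  linear_combination (-(Nat.choose (j+2*k+1) j : ℝ)) * h1' + (Nat.choose (2*(j+k)) j : ℝ) * h2'

theorem sum_aOdd_div_choose (m : ℕ) (hm : 1 ≤ m) :
    ∑ i ∈ Finset.range (m + 1), aOdd m i / (Nat.choose (2 * m) (m - i) : ℝ) =
      -(Nat.factorial (2 * m + 1) : ℝ) / 2 ^ (2 * m) := by
  have key : ∀ j ∈ Finset.range (m+1),
      aOdd m (m + 1 - 1 - j) / (Nat.choose (2 * m) (m - (m + 1 - 1 - j)) : ℝ) =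
      -(Nat.factorial (2 * m + 1) : ℝ) *
        (2 * ((Nat.choose (2*m+1-j) j : ℝ) * (-1/4 : ℝ) ^ j)
          - (Nat.choose (2*m-j) j : ℝ) * (-1/4 : ℝ) ^ j) := by
    intro j hj
    have hj : j ≤ m := by simp at hj; omega
    have e := term_eq_s3 m j hj
    unfold aOdd
    have e1 : m - (m + 1 - 1 - j) = j := by omega
    have e2 : m + (m + 1 - 1 - j) + 1 = 2*m+1-j := by omega
    have e3 : (2 * ((m + 1 - 1 - j : ℕ) : ℤ)) - 2 * (m : ℤ) = -((2 * j : ℕ) : ℤ) := by omega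
    rw [e1, e2, e3, zpow_neg, zpow_natCast, pow_mul]
    have e4 : (-1/4 : ℝ)^j = (-1)^j * ((2^2)^j)⁻¹ := by
      rw [← inv_pow, ← mul_pow]; norm_num
    rw [e4, pow_succ]
    linear_combination (-(-1:ℝ)^j * ((2^2)^j)⁻¹ * (Nat.factorial (2 * m + 1) : ℝ)) * e
  rw [← Finset.sum_range_reflect, Finset.sum_congr rfl key, ← Finset.mul_sum,
    Finset.sum_sub_distrib, ← Finset.mul_sum, F_range _ _ (by omega) (by omega),
    F_range _ _ (by omega) (by omega)]
  push_cast
  field_simp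
  ring
end

section
/- For every integer m ≥ 1, (m+1) · Σ_{i=0}^{m} a_{2m,2i} / C(2m, m−i) = (2m+2)! / 2^{2m+1}. -/
open Finset

lemma S_aux (n : ℕ) : ∑ p ∈ Finset.HasAntidiagonal.antidiagonal n, (Nat.choose p.1 p.2 : ℝ) * (-1/4) ^ p.2
    = (n + 1) / 2 ^ n := by
  induction n using Nat.twoStepInduction with
  | zero => simp
  | one => simp [Finset.Nat.antidiagonal_succ]
  | more n h1 h2 =>
    have key : ∑ p ∈ Finset.HasAntidiagonal.antidiagonal (n+2), (Nat.choose p.1 p.2 : ℝ) * (-1/4) ^ p.2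
      = ∑ p ∈ Finset.HasAntidiagonal.antidiagonal (n+1), (Nat.choose p.1 p.2 : ℝ) * (-1/4) ^ p.2
       + (-1/4) * ∑ p ∈ Finset.HasAntidiagonal.antidiagonal n, (Nat.choose p.1 p.2 : ℝ) * (-1/4) ^ p.2 := by
      rw [Finset.Nat.antidiagonal_succ_succ', Finset.Nat.antidiagonal_succ', Finset.mul_sum]
      simp [Nat.choose_succ_succ, Finset.sum_add_distrib, add_mul, pow_succ]
      have : ∀ x : ℕ × ℕ, (Nat.choose x.1 x.2 : ℝ) * ((-1/4) ^ x.2 * (-1/4)) = (-1/4) * (Nat.choose x.1 x.2 * (-1/4) ^ x.2) := by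
        intro x; ring
      simp only [this]
      ring
    rw [key, h1, h2]
    push_cast
    field_simp
    ring

lemma S_aux2 (m : ℕ) : ∑ i ∈ Finset.range (m + 1),
    (Nat.choose (m + i) (m - i) : ℝ) * (-1/4) ^ (m - i) = (2 * m + 1) / 2 ^ (2 * m) := by
  have h := S_aux (2 * m)
  rw [← Finset.Nat.sum_antidiagonal_swap, Finset.Nat.sum_antidiagonal_eq_sum_range_succ_mk] at h
  simp only [Prod.fst_swap, Prod.snd_swap] at h
  push_cast at h
  rw [← h, ← Finset.sum_range_reflect]
  have hs : Finset.range (m + 1) ⊆ Finset.range (2 * m).succ := by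
    intro x; simp only [Finset.mem_range]; omega
  rw [← Finset.sum_subset hs]
  · apply Finset.sum_congr rfl
    intro x hx
    rw [Finset.mem_range] at hx
    have e1 : m + (m + 1 - 1 - x) = 2 * m - x := by omega
    have e2 : m - (m + 1 - 1 - x) = x := by omega
    rw [e1, e2]
  · intro x _ hx
    rw [Finset.mem_range] at hx
    rw [Nat.choose_eq_zero_of_lt (by omega)]
    simp

theorem sum_aEven_div_choose (m : ℕ) (hm : 1 ≤ m) :
    ((m : ℝ) + 1) * ∑ i ∈ Finset.range (m + 1), aEven m i / (Nat.choose (2 * m) (m - i) : ℝ) =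
      (Nat.factorial (2 * m + 2) : ℝ) / 2 ^ (2 * m + 1) := by
  have h : ∀ i ∈ Finset.range (m + 1), aEven m i / (Nat.choose (2 * m) (m - i) : ℝ)
      = (Nat.factorial (2 * m) : ℝ) * ((Nat.choose (m + i) (m - i) : ℝ) * (-1/4) ^ (m - i)) := by
    intro i hi
    rw [Finset.mem_range] at hi
    have hc : (Nat.choose (2 * m) (m - i) : ℝ) ≠ 0 := by
      have := Nat.choose_pos (n := 2 * m) (k := m - i) (by omega)
      positivity
    have hp : (2 : ℝ) ^ ((2 * (i : ℤ)) - 2 * (m : ℤ)) = (1/4) ^ (m - i) := by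
      have : (2 * (i : ℤ)) - 2 * (m : ℤ) = -((2 * (m - i) : ℕ) : ℤ) := by omega
      rw [this, zpow_neg, zpow_natCast, pow_mul, ← inv_pow]
      norm_num
    have hq : (-1/4 : ℝ) ^ (m - i) = (-1) ^ (m - i) * (1/4) ^ (m - i) := by
      rw [← mul_pow]; norm_num
    rw [aEven, hp, hq, div_eq_iff hc]
    ring
  rw [Finset.sum_congr rfl h, ← Finset.mul_sum, S_aux2, Nat.factorial_succ, Nat.factorial_succ]
  push_cast
  field_simp
  ring
end

section
/- For every integer m ≥ 1, Σ_{i=0}^{m} a_{2m+1,2i+1} / C(2m+1, m−i) = −(2m+2)! / 2^{2m+1}. -/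
open Finset

theorem aux_sum_antidiag (n : ℕ) :
    ∑ p ∈ Finset.HasAntidiagonal.antidiagonal n, (Nat.choose p.1 p.2 : ℝ) * (-1 / 4 : ℝ) ^ p.2 =
      ((n : ℝ) + 1) / 2 ^ n := by
  induction n using Nat.twoStepInduction with
  | zero => simp
  | one => simp [Finset.Nat.antidiagonal_succ]
  | more n h1 h2 =>
    have key : ∑ p ∈ Finset.HasAntidiagonal.antidiagonal (n + 2), (Nat.choose p.1 p.2 : ℝ) * (-1 / 4 : ℝ) ^ p.2 =
        ∑ p ∈ Finset.HasAntidiagonal.antidiagonal (n + 1), (Nat.choose p.1 p.2 : ℝ) * (-1 / 4 : ℝ) ^ p.2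
        + (-1 / 4) * ∑ p ∈ Finset.HasAntidiagonal.antidiagonal n, (Nat.choose p.1 p.2 : ℝ) * (-1 / 4 : ℝ) ^ p.2 := by
      rw [Finset.Nat.antidiagonal_succ_succ', Finset.Nat.antidiagonal_succ']
      simp only [Finset.sum_cons, Finset.sum_map, Finset.mul_sum]
      simp [Nat.choose_succ_succ, Finset.sum_add_distrib, add_mul, pow_succ]
      simp only [add_assoc, add_comm, add_left_comm, mul_comm, mul_left_comm]
    rw [key, h1, h2]
    push_cast
    field_simp
    ring

theorem aux_sum_range (m : ℕ) :
    ∑ j ∈ Finset.range (m + 1), (Nat.choose (2 * m + 1 - j) j : ℝ) * (-1 / 4 : ℝ) ^ j =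
      (2 * (m : ℝ) + 2) / 2 ^ (2 * m + 1) := by
  have h := aux_sum_antidiag (2 * m + 1)
  rw [← Finset.Nat.sum_antidiagonal_swap] at h
  rw [Finset.Nat.sum_antidiagonal_eq_sum_range_succ_mk] at h
  simp only [Prod.swap, Prod.fst, Prod.snd] at h
  rw [Finset.sum_subset (s₂ := Finset.range (2 * m + 1).succ), h]
  · push_cast; ring
  · intro x hx
    simp only [Finset.mem_range] at *
    omega
  · intro x hx hx'
    simp only [Finset.mem_range] at *
    rw [Nat.choose_eq_zero_of_lt (by omega)]
    simp

theorem sum_aOdd_div_choose_succ (m : ℕ) (hm : 1 ≤ m) :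
    ∑ i ∈ Finset.range (m + 1), aOdd m i / (Nat.choose (2 * m + 1) (m - i) : ℝ) =
      -(Nat.factorial (2 * m + 2) : ℝ) / 2 ^ (2 * m + 1) := by
  rw [← Finset.sum_range_reflect]
  have h : ∀ j ∈ Finset.range (m + 1),
      aOdd m (m + 1 - 1 - j) / (Nat.choose (2 * m + 1) (m - (m + 1 - 1 - j)) : ℝ) =
      -(Nat.factorial (2 * m + 1) : ℝ) *
        ((Nat.choose (2 * m + 1 - j) j : ℝ) * (-1 / 4 : ℝ) ^ j) := by
    intro j hj
    rw [Finset.mem_range] at hj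
    obtain ⟨k, rfl⟩ : ∃ k, m = k + j := ⟨m - j, by omega⟩
    have e1 : k + j + 1 - 1 - j = k := by omega
    have e2 : k + j - k = j := by omega
    have e3 : 2 * (k + j) + 1 - j = k + j + k + 1 := by omega
    have e4 : (2 : ℝ) ^ (2 * (k : ℤ) - 2 * ((k + j : ℕ) : ℤ)) = (1 / 4) ^ j := by
      have : 2 * (k : ℤ) - 2 * ((k + j : ℕ) : ℤ) = -((2 * j : ℕ) : ℤ) := by push_cast; ring
      rw [this, zpow_neg, zpow_natCast, pow_mul, one_div, inv_pow]
      norm_num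
    have hc : (Nat.choose (2 * (k + j) + 1) j : ℝ) ≠ 0 := by
      exact_mod_cast (Nat.choose_pos (by omega)).ne'
    have e5 : (-1 / 4 : ℝ) ^ j = (-1) ^ j * (1 / 4) ^ j := by
      rw [← mul_pow]; norm_num
    rw [e1, aOdd, e2, e3, e4, e5, div_eq_iff hc, pow_succ]
    ring
  rw [Finset.sum_congr rfl h, ← Finset.mul_sum, aux_sum_range, Nat.factorial_succ (2 * m + 1)]
  push_cast
  ring
end

section
/- For every integer m ≥ 2 and all real s, t, the identity P_m(s,t) + (2m−1) s · P_{m−1}(s,t) + (m−1)² (s² + t²) · P_{m−2}(s,t) = 0 holds. -/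
open Finset

/-- The polynomials `P_n(s,t)`: for `n = 2m`, `P_{2m}(s,t) = Σ a_{2m,2i} s^{2i} t^{2(m-i)}`,
and for `n = 2m+1`, `P_{2m+1}(s,t) = Σ a_{2m+1,2i+1} s^{2i+1} t^{2(m-i)}`. -/
noncomputable def Ppoly (n : ℕ) (s t : ℝ) : ℝ :=
  if n % 2 = 0 then
    ∑ i ∈ Finset.range (n / 2 + 1), aEven (n / 2) i * s ^ (2 * i) * t ^ (2 * (n / 2 - i))
  else
    ∑ i ∈ Finset.range (n / 2 + 1), aOdd (n / 2) i * s ^ (2 * i + 1) * t ^ (2 * (n / 2 - i))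

noncomputable def uu (n k : ℕ) : ℝ :=
  (-1 : ℝ) ^ n * (-1 / 4 : ℝ) ^ k * (Nat.factorial n : ℝ) * (Nat.choose n k : ℝ) *
    (Nat.choose (n - k) k : ℝ)

theorem uu_zero {n k : ℕ} (h : n < 2 * k) : uu n k = 0 := by
  unfold uu
  rw [Nat.choose_eq_zero_of_lt (show n - k < k by omega)]
  simp

theorem uu_eq (j k n : ℕ) (h : n = j + 2 * k) :
    uu n k = (-1 : ℝ) ^ j * (-1 / 4 : ℝ) ^ k * (Nat.factorial n : ℝ) ^ 2 /
      ((Nat.factorial k : ℝ) ^ 2 * (Nat.factorial j : ℝ)) := by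
  have h1 := Nat.choose_mul_factorial_mul_factorial (show k ≤ n by omega)
  have h2 := Nat.choose_mul_factorial_mul_factorial (show k ≤ n - k by omega)
  rw [show n - k - k = j by omega] at h2
  have h3 : (n.choose k : ℝ) * k.factorial * (n - k).factorial = n.factorial := by
    exact_mod_cast h1
  have h4 : ((n - k).choose k : ℝ) * k.factorial * j.factorial = (n - k).factorial := by
    exact_mod_cast h2
  have hs : (-1 : ℝ) ^ n = (-1) ^ j := by
    rw [h, pow_add, pow_mul]; simp
  unfold uu
  rw [hs]
  have a := Nat.factorial_pos k
  have b := Nat.factorial_pos j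
  rw [eq_div_iff (by positivity)]
  rw [← h4] at h3
  linear_combination ((-1 : ℝ) ^ j * (-1 / 4 : ℝ) ^ k * (n.factorial : ℝ)) * h3

noncomputable def ff (s t : ℝ) (n k : ℕ) : ℝ := uu n k * s ^ (n - 2 * k) * t ^ (2 * k)

theorem Ppoly_ff (n N : ℕ) (h : n / 2 < N) (s t : ℝ) :
    Ppoly n s t = ∑ k ∈ Finset.range N, ff s t n k := by
  have e : ∑ k ∈ Finset.range N, ff s t n k = ∑ k ∈ Finset.range (n / 2 + 1), ff s t n k := by
    symm
    apply Finset.sum_subset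
    · intro x; simp only [Finset.mem_range]; omega
    · intro x _ hx
      simp only [Finset.mem_range] at hx
      unfold ff
      rw [uu_zero (by omega)]; simp
  rw [e, ← Finset.sum_range_reflect]
  unfold Ppoly
  have p4 : ∀ m i : ℕ, i ≤ m → (2 : ℝ) ^ ((2 * (i : ℤ)) - 2 * (m : ℤ)) = (1 / 4) ^ (m - i) := by
    intro m i hi
    obtain ⟨d, rfl⟩ := Nat.exists_eq_add_of_le hi
    rw [show (2 * (i : ℤ)) - 2 * ((i + d : ℕ) : ℤ) = -((2 * d : ℕ) : ℤ) by push_cast; ring,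
      zpow_neg, zpow_natCast, pow_mul, show i + d - i = d by omega,
      one_div, inv_pow]
    norm_num
  have p5 : ∀ d : ℕ, (-1 / 4 : ℝ) ^ d = (-1) ^ d * (1 / 4) ^ d := by
    intro d; rw [← mul_pow]; norm_num
  split_ifs with hp
  · apply Finset.sum_congr rfl
    intro i hi
    simp only [Finset.mem_range] at hi
    obtain ⟨m, rfl⟩ : ∃ m, n = 2 * m := ⟨n / 2, by omega⟩
    rw [show 2 * m / 2 = m by omega] at *
    unfold ff uu aEven
    rw [p4 m i (by omega), show m + 1 - 1 - i = m - i by omega, p5,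
      show 2 * m - (m - i) = m + i by omega, show 2 * m - 2 * (m - i) = 2 * i by omega, pow_mul (-1 : ℝ) 2 m]
    simp only [even_two, Even.neg_pow, one_pow]
    ring
  · apply Finset.sum_congr rfl
    intro i hi
    simp only [Finset.mem_range] at hi
    obtain ⟨m, rfl⟩ : ∃ m, n = 2 * m + 1 := ⟨n / 2, by omega⟩
    rw [show (2 * m + 1) / 2 = m by omega] at *
    unfold ff uu aOdd
    rw [p4 m i (by omega), show m + 1 - 1 - i = m - i by omega, p5,
      show 2 * m + 1 - (m - i) = m + i + 1 by omega,
      show 2 * m + 1 - 2 * (m - i) = 2 * i + 1 by omega, pow_succ (-1 : ℝ) (2 * m), pow_mul (-1 : ℝ) 2 m]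
    simp only [even_two, Even.neg_pow, one_pow]
    ring

theorem ff_zero (s t : ℝ) (n : ℕ) : ff s t (n + 2) 0 + (2 * (n : ℝ) + 3) * s * ff s t (n + 1) 0 +
    ((n : ℝ) + 1) ^ 2 * s ^ 2 * ff s t n 0 = 0 := by
  simp only [ff, uu, Nat.factorial_succ]
  simp
  ring

theorem ff_succ (s t : ℝ) (n k : ℕ) :
    ff s t (n + 2) (k + 1) + (2 * (n : ℝ) + 3) * s * ff s t (n + 1) (k + 1) +
    ((n : ℝ) + 1) ^ 2 * (s ^ 2 * ff s t n (k + 1) + t ^ 2 * ff s t n k) = 0 := by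
  have fn := Nat.factorial_pos n
  have fk := Nat.factorial_pos k
  unfold ff
  rcases lt_or_ge n (2 * k) with h | h
  · rw [uu_zero (by omega), uu_zero (by omega), uu_zero (by omega), uu_zero (by omega)]; simp
  obtain ⟨j, rfl⟩ := Nat.exists_eq_add_of_le h
  rcases j with _ | _ | j
  · rw [uu_zero (n := 2 * k + 0 + 1) (by omega), uu_zero (n := 2 * k + 0) (k := k + 1) (by omega),
      uu_eq 0 (k + 1) _ (by omega), uu_eq 0 k _ (by omega)]
    rw [show 2 * k + 0 + 2 - 2 * (k + 1) = 0 by omega, show 2 * k + 0 - 2 * k = 0 by omega]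
    simp only [Nat.factorial_succ, add_zero, Nat.factorial_zero] at *
    push_cast
    field_simp
    ring
  · rw [uu_zero (n := 2 * k + (0 + 1)) (k := k + 1) (by omega),
      uu_eq 1 (k + 1) _ (by omega), uu_eq 0 (k + 1) _ (by omega), uu_eq 1 k _ (by omega)]
    rw [show 2 * k + (0 + 1) + 2 - 2 * (k + 1) = 1 by omega,
      show 2 * k + (0 + 1) + 1 - 2 * (k + 1) = 0 by omega,
      show 2 * k + (0 + 1) - 2 * k = 1 by omega]
    simp only [Nat.factorial_succ, Nat.factorial_zero] at *
    push_cast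
    field_simp
    ring
  · have fj := Nat.factorial_pos j
    rw [uu_eq (j + 2) (k + 1) _ (by omega), uu_eq (j + 1) (k + 1) _ (by omega),
      uu_eq j (k + 1) _ (by omega), uu_eq (j + 2) k _ (by omega)]
    rw [show 2 * k + (j + 1 + 1) + 2 - 2 * (k + 1) = j + 2 by omega,
      show 2 * k + (j + 1 + 1) + 1 - 2 * (k + 1) = j + 1 by omega,
      show 2 * k + (j + 1 + 1) - 2 * (k + 1) = j by omega,
      show 2 * k + (j + 1 + 1) - 2 * k = j + 2 by omega]
    generalize hn : 2 * k + (j + 1 + 1) = n at *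
    have hc : (n : ℝ) = 2 * k + j + 2 := by rw [← hn]; push_cast; ring
    simp only [Nat.factorial_succ] at *
    push_cast
    rw [hc]
    field_simp
    ring

theorem Ppoly_three_term (m : ℕ) (hm : 2 ≤ m) (s t : ℝ) :
    Ppoly m s t + (2 * (m : ℝ) - 1) * s * Ppoly (m - 1) s t +
      ((m : ℝ) - 1) ^ 2 * (s ^ 2 + t ^ 2) * Ppoly (m - 2) s t = 0 := by
  obtain ⟨n, rfl⟩ := Nat.exists_eq_add_of_le' hm
  rw [show n + 2 - 1 = n + 1 by omega, show n + 2 - 2 = n by omega]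
  have h1 := Ppoly_ff (n + 2) (n + 1 + 1) (by omega) s t
  have h2 := Ppoly_ff (n + 1) (n + 1 + 1) (by omega) s t
  have h3 := Ppoly_ff n (n + 1 + 1) (by omega) s t
  have h4 := Ppoly_ff n (n + 1) (by omega) s t
  rw [Finset.sum_range_succ'] at h1 h2 h3
  have h5 := Finset.sum_eq_zero (s := Finset.range (n + 1)) (fun k _ => ff_succ s t n k)
  simp only [Finset.sum_add_distrib, ← Finset.mul_sum] at h5
  have h6 := ff_zero s t n
  push_cast
  linear_combination h1 + (2 * (n : ℝ) + 3) * s * h2 + ((n : ℝ) + 1) ^ 2 * s ^ 2 * h3 +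
    ((n : ℝ) + 1) ^ 2 * t ^ 2 * h4 + h5 + h6
end

section
/- For every integer m ≥ 1 and all real s, t, the derivative with respect to s of the function s ↦ P_m(s,t) equals −m² · P_{m−1}(s,t). -/
open Finset

lemma choose_aux (n k : ℕ) :
    (Nat.choose (n + k) k : ℝ) * ((n : ℝ) + k + 1) = (Nat.choose (n + k + 1) k : ℝ) * ((n : ℝ) + 1) := by
  have h := Nat.choose_mul_succ_eq (n + k) k
  have e : n + k + 1 - k = n + 1 := by omega
  rw [e] at h
  exact_mod_cast h

lemma odd_coeff (i k : ℕ) :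
    aOdd (i + k) i * (2 * (i : ℝ) + 1) = -(2 * ((i : ℝ) + k) + 1) ^ 2 * aEven (i + k) i := by
  unfold aOdd aEven
  have h1 := choose_aux (2 * i + k) k
  have h2 := choose_aux (2 * i) k
  have e0 : i + k - i = k := by omega
  have e1 : 2 * (i + k) = 2 * i + k + k := by omega
  have e2 : i + k + i = 2 * i + k := by omega
  rw [e0, e1, e2, Nat.factorial_succ]
  push_cast at h1 h2 ⊢
  have hp : (2 * (i : ℝ) + k + 1) ≠ 0 := by positivity
  apply mul_right_cancel₀ hp
  generalize (2 : ℝ) ^ (_ : ℤ) = z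
  generalize ((2 * i + k + k).factorial : ℝ) = f
  rw [pow_succ (-1 : ℝ) k]
  generalize (-1 : ℝ) ^ k = g
  linear_combination (g * z * (2 * i + k + k + 1) * f) * (((2 * i + k + k + 1).choose k : ℝ) * (2 * i + k + 1) * h2 + ((2 * i + k).choose k : ℝ) * (2 * i + k + 1) * h1)

lemma even_coeff (i k : ℕ) :
    aEven (i + k + 1) (i + 1) * (2 * (i : ℝ) + 2) = -(2 * ((i : ℝ) + k) + 2) ^ 2 * aOdd (i + k) i := by
  unfold aOdd aEven
  have h1 := choose_aux (2 * i + k + 1) k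
  have h2 := choose_aux (2 * i + 1) k
  have e0 : i + k - i = k := by omega
  have e0' : i + k + 1 - (i + 1) = k := by omega
  have e1 : 2 * (i + k + 1) = (2 * i + k + 1 + k) + 1 := by omega
  have e1' : 2 * (i + k) + 1 = 2 * i + k + 1 + k := by omega
  have e2 : i + k + 1 + (i + 1) = 2 * i + 1 + k + 1 := by omega
  have e2' : i + k + i + 1 = 2 * i + 1 + k := by omega
  have e3 : (2 * ((i + 1 : ℕ) : ℤ) - 2 * ((i + k + 1 : ℕ) : ℤ)) = 2 * (i : ℤ) - 2 * ((i + k : ℕ) : ℤ) := by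
    push_cast; ring
  rw [e0, e0', e3, e1, e1', e2, e2', Nat.factorial_succ]
  push_cast at h1 h2 ⊢
  have hp : (2 * (i : ℝ) + k + 2) ≠ 0 := by positivity
  apply mul_right_cancel₀ hp
  generalize (2 : ℝ) ^ (_ : ℤ) = z
  generalize ((2 * i + k + 1 + k).factorial : ℝ) = f
  rw [pow_succ (-1 : ℝ) k]
  generalize (-1 : ℝ) ^ k = g
  linear_combination (-g * z * (2 * i + k + k + 2) * f) * (((2 * i + k + 1 + k + 1).choose k : ℝ) * (2 * i + k + 2) * h2 + ((2 * i + 1 + k).choose k : ℝ) * (2 * i + k + 2) * h1)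

theorem deriv_Ppoly (m : ℕ) (hm : 1 ≤ m) (s t : ℝ) :
    deriv (fun s' => Ppoly m s' t) s = -(m : ℝ) ^ 2 * Ppoly (m - 1) s t := by
  have key : ∀ (N : ℕ) (c : ℕ → ℝ) (e : ℕ → ℕ) (d : ℕ → ℝ),
      deriv (fun x : ℝ => ∑ i ∈ Finset.range N, c i * x ^ (e i) * d i) s
        = ∑ i ∈ Finset.range N, c i * ((e i : ℝ) * s ^ (e i - 1)) * d i := by
    intro N c e d
    apply HasDerivAt.deriv
    apply HasDerivAt.fun_sum
    intro i _
    exact ((hasDerivAt_pow (e i) s).const_mul (c i)).mul_const (d i)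
  obtain ⟨n, rfl | rfl⟩ : ∃ n, m = 2 * n + 1 ∨ m = 2 * n + 2 := ⟨(m - 1) / 2, by omega⟩
  · have a1 : (2 * n + 1) % 2 ≠ 0 := by omega
    have a2 : (2 * n + 1) / 2 = n := by omega
    have a3 : (2 * n) % 2 = 0 := by omega
    have a4 : (2 * n) / 2 = n := by omega
    simp only [Ppoly, Nat.add_sub_cancel, if_neg a1, if_pos a3, a2, a4]
    rw [key, Finset.mul_sum]
    apply Finset.sum_congr rfl
    intro i hi
    obtain ⟨k, rfl⟩ := Nat.exists_eq_add_of_le (Nat.lt_succ_iff.mp (Finset.mem_range.mp hi))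
    have h := odd_coeff i k
    rw [Nat.add_sub_cancel]
    push_cast
    linear_combination (s ^ (2 * i) * t ^ (2 * (i + k - i))) * h
  · have a1 : (2 * n + 2) % 2 = 0 := by omega
    have a2 : (2 * n + 2) / 2 = n + 1 := by omega
    have a3 : (2 * n + 1) % 2 ≠ 0 := by omega
    have a4 : (2 * n + 1) / 2 = n := by omega
    have a5 : 2 * n + 2 - 1 = 2 * n + 1 := by omega
    simp only [Ppoly, a5, if_pos a1, if_neg a3, a2, a4]
    rw [key, Finset.mul_sum, Finset.sum_range_succ']
    simp only [Nat.mul_zero, Nat.cast_zero, zero_mul, mul_zero, add_zero]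
    apply Finset.sum_congr rfl
    intro i hi
    obtain ⟨k, rfl⟩ := Nat.exists_eq_add_of_le (Nat.lt_succ_iff.mp (Finset.mem_range.mp hi))
    have h := even_coeff i k
    have b1 : 2 * (i + 1) - 1 = 2 * i + 1 := by omega
    have b2 : i + k + 1 - (i + 1) = i + k - i := by omega
    rw [b1, b2]
    push_cast
    linear_combination (s ^ (2 * i + 1) * t ^ (2 * (i + k - i))) * h
end

section
/- For every integer m ≥ 2: a_{2m,0} = a_{2m−1,1}; for every integer i with 1 ≤ i ≤ m−1, a_{2m,2i} = (2i − 4m) · a_{2m−1,2i−1} + (2i + 1) · a_{2m−1,2i+1}; and a_{2m,2m} = −2m · a_{2m−1,2m−1}. -/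
open Finset

lemma two_zpow_aux (i k : ℕ) :
    (2 : ℝ) ^ ((2 * (i : ℤ)) - 2 * ((i + k : ℕ) : ℤ)) = ((4 : ℝ) ^ k)⁻¹ := by
  have : (2 * (i : ℤ)) - 2 * ((i + k : ℕ) : ℤ) = -((2 * k : ℕ) : ℤ) := by push_cast; ring
  rw [this, zpow_neg, zpow_natCast, pow_mul]
  norm_num

lemma aEven_eq (i k : ℕ) : aEven (i + k) i =
    (-1 : ℝ) ^ k * ((4 : ℝ) ^ k)⁻¹ * (Nat.factorial (2 * (i + k)) : ℝ) ^ 2 /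
      ((Nat.factorial k : ℝ) ^ 2 * (Nat.factorial (2 * i) : ℝ)) := by
  unfold aEven
  rw [two_zpow_aux, Nat.add_sub_cancel_left,
    Nat.cast_choose ℝ (show k ≤ 2 * (i + k) by omega),
    Nat.cast_choose ℝ (show k ≤ i + k + i by omega),
    show 2 * (i + k) - k = i + k + i by omega, show i + k + i - k = 2 * i by omega]
  have h1 := Nat.cast_ne_zero (R := ℝ).2 (Nat.factorial_ne_zero k)
  have h2 := Nat.cast_ne_zero (R := ℝ).2 (Nat.factorial_ne_zero (i + k + i))
  have h3 := Nat.cast_ne_zero (R := ℝ).2 (Nat.factorial_ne_zero (2 * i))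
  field_simp

lemma aOdd_eq (i k : ℕ) : aOdd (i + k) i =
    (-1 : ℝ) ^ (k + 1) * ((4 : ℝ) ^ k)⁻¹ * (Nat.factorial (2 * (i + k) + 1) : ℝ) ^ 2 /
      ((Nat.factorial k : ℝ) ^ 2 * (Nat.factorial (2 * i + 1) : ℝ)) := by
  unfold aOdd
  rw [two_zpow_aux, Nat.add_sub_cancel_left,
    Nat.cast_choose ℝ (show k ≤ 2 * (i + k) + 1 by omega),
    Nat.cast_choose ℝ (show k ≤ i + k + i + 1 by omega),
    show 2 * (i + k) + 1 - k = i + k + i + 1 by omega,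
    show i + k + i + 1 - k = 2 * i + 1 by omega]
  have h1 := Nat.cast_ne_zero (R := ℝ).2 (Nat.factorial_ne_zero k)
  have h2 := Nat.cast_ne_zero (R := ℝ).2 (Nat.factorial_ne_zero (i + k + i + 1))
  have h3 := Nat.cast_ne_zero (R := ℝ).2 (Nat.factorial_ne_zero (2 * i + 1))
  field_simp

theorem aEven_recurrence (m : ℕ) (hm : 2 ≤ m) :
    aEven m 0 = aOdd (m - 1) 0 ∧
    (∀ i : ℕ, 1 ≤ i → i ≤ m - 1 →
      aEven m i = (2 * (i : ℝ) - 4 * m) * aOdd (m - 1) (i - 1) + (2 * (i : ℝ) + 1) * aOdd (m - 1) i) ∧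
    aEven m m = -(2 * (m : ℝ)) * aOdd (m - 1) (m - 1) := by
  refine ⟨?_, ?_, ?_⟩
  · obtain ⟨n, rfl⟩ : ∃ n, m = n + 1 := ⟨m - 1, by omega⟩
    have e := aEven_eq 0 (n + 1)
    have o := aOdd_eq 0 n
    rw [zero_add] at e o
    rw [Nat.add_sub_cancel, e, o, show 2 * (n + 1) = (2 * n + 1) + 1 by ring,
      Nat.factorial_succ (2 * n + 1), Nat.factorial_succ n]
    have h1 := Nat.cast_ne_zero (R := ℝ).2 (Nat.factorial_ne_zero n)
    have h2 : (n : ℝ) + 1 ≠ 0 := by positivity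
    simp only [mul_zero, zero_add, Nat.factorial_zero, Nat.factorial_one]
    push_cast
    field_simp
    ring
  · intro i hi him
    obtain ⟨j, rfl⟩ : ∃ j, i = j + 1 := ⟨i - 1, by omega⟩
    obtain ⟨k, rfl⟩ : ∃ k, m = j + 1 + (k + 1) := ⟨m - (j + 2), by omega⟩
    have e := aEven_eq (j + 1) (k + 1)
    have o1 := aOdd_eq j (k + 1)
    have o2 := aOdd_eq (j + 1) k
    rw [show j + 1 + (k + 1) - 1 = j + (k + 1) by omega, Nat.add_sub_cancel, e, o1,
      show j + (k + 1) = j + 1 + k by ring, o2,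
      show 2 * (j + 1 + (k + 1)) = (2 * (j + 1 + k) + 1) + 1 by ring,
      Nat.factorial_succ (2 * (j + 1 + k) + 1), Nat.factorial_succ k,
      Nat.factorial_succ (2 * (j + 1)), show 2 * (j + 1) = 2 * j + 1 + 1 by ring,
      Nat.factorial_succ (2 * j + 1)]
    have h1 := Nat.cast_ne_zero (R := ℝ).2 (Nat.factorial_ne_zero k)
    have h3 := Nat.cast_ne_zero (R := ℝ).2 (Nat.factorial_ne_zero (2 * j + 1))
    have h2 : (k : ℝ) + 1 ≠ 0 := by positivity
    have h4 : 2 * (j : ℝ) + 1 + 1 ≠ 0 := by positivity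
    have h5 : 2 * (j : ℝ) + 1 + 1 + 1 ≠ 0 := by positivity
    have h6 : 2 * ((j : ℝ) + 1) + 1 ≠ 0 := by positivity
    generalize Nat.factorial (2 * (j + 1 + k) + 1) = F at *
    generalize Nat.factorial (2 * j + 1) = G at *
    generalize Nat.factorial k = K at *
    push_cast
    simp only [pow_succ (-1 : ℝ), pow_succ (4 : ℝ)]
    field_simp
    ring
  · obtain ⟨n, rfl⟩ : ∃ n, m = n + 1 := ⟨m - 1, by omega⟩
    have e := aEven_eq (n + 1) 0
    have o := aOdd_eq n 0
    rw [add_zero] at e o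
    rw [Nat.add_sub_cancel, e, o, show 2 * (n + 1) = (2 * n + 1) + 1 by ring,
      Nat.factorial_succ (2 * n + 1)]
    have h1 := Nat.cast_ne_zero (R := ℝ).2 (Nat.factorial_ne_zero (2 * n + 1))
    have h2 : 2 * (n : ℝ) + 1 + 1 ≠ 0 := by positivity
    simp only [Nat.factorial_zero]
    push_cast
    field_simp
    ring
end

section
/- For every integer m ≥ 1: for every integer i with 0 ≤ i ≤ m−1, a_{2m+1,2i+1} = (2i − 4m − 1) · a_{2m,2i} + (2i + 2) · a_{2m,2i+2}; and a_{2m+1,2m+1} = −(2m+1) · a_{2m,2m}. -/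
open Finset

theorem aOdd_recurrence (m : ℕ) (hm : 1 ≤ m) :
    (∀ i : ℕ, i ≤ m - 1 →
      aOdd m i = (2 * (i : ℝ) - 4 * m - 1) * aEven m i + (2 * (i : ℝ) + 2) * aEven m (i + 1)) ∧
    aOdd m m = -(2 * (m : ℝ) + 1) * aEven m m := by
  constructor
  · intro i hi
    obtain ⟨d, rfl⟩ : ∃ d, m = i + 1 + d := ⟨m - (i + 1), by omega⟩
    have e1 : i + 1 + d - i = d + 1 := by omega
    have e2 : i + 1 + d - (i + 1) = d := by omega
    have z1 : (2 : ℝ) ^ ((2 * (i : ℤ)) - 2 * ((i + 1 + d : ℕ) : ℤ)) = (1 / 4) * (1 / 4) ^ d := by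
      have : (2 * (i : ℤ)) - 2 * ((i + 1 + d : ℕ) : ℤ) = -((2 * (d + 1) : ℕ) : ℤ) := by
        push_cast; ring
      rw [this, zpow_neg, zpow_natCast, pow_mul, pow_succ, mul_inv, ← inv_pow]
      norm_num [mul_comm]
    have z2 : (2 : ℝ) ^ ((2 * ((i + 1 : ℕ) : ℤ)) - 2 * ((i + 1 + d : ℕ) : ℤ)) = (1 / 4) ^ d := by
      have : (2 * ((i + 1 : ℕ) : ℤ)) - 2 * ((i + 1 + d : ℕ) : ℤ) = -((2 * d : ℕ) : ℤ) := by
        push_cast; ring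
      rw [this, zpow_neg, zpow_natCast, pow_mul, ← inv_pow]
      norm_num
    unfold aOdd aEven
    rw [e1, e2, z1, z2, Nat.factorial_succ]
    have r1 : i + 1 + d + (i + 1) = i + 1 + d + i + 1 := by omega
    rw [r1]
    have h1 := Nat.choose_succ_right_eq (2 * (i + 1 + d)) d
    have h2 := Nat.add_one_mul_choose_eq (2 * (i + 1 + d)) d
    have h3 := Nat.choose_succ_right_eq (i + 1 + d + i + 1) d
    have h4 := Nat.add_one_mul_choose_eq (i + 1 + d + i) d
    have h5 := Nat.choose_succ_right_eq (i + 1 + d + i) d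
    rw [show 2 * (i + 1 + d) - d = 2 * i + d + 2 by omega] at h1
    rw [show i + 1 + d + i + 1 - d = 2 * i + 2 by omega] at h3
    rw [show i + 1 + d + i - d = 2 * i + 1 by omega] at h5
    generalize Nat.choose (2 * (i + 1 + d)) d = A at *
    generalize Nat.choose (2 * (i + 1 + d)) (d + 1) = A1 at *
    generalize Nat.choose (2 * (i + 1 + d) + 1) (d + 1) = A2 at *
    generalize Nat.choose (i + 1 + d + i + 1) d = B at *
    generalize Nat.choose (i + 1 + d + i + 1) (d + 1) = B1 at *
    generalize Nat.choose (i + 1 + d + i) (d + 1) = B2 at *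
    generalize Nat.choose (i + 1 + d + i) d = B3 at *
    generalize Nat.factorial (2 * (i + 1 + d)) = F
    have g1 : (A1 : ℝ) * (d + 1) = A * (2 * i + d + 2) := by exact_mod_cast h1
    have g2 : (2 * (i + 1 + d) + 1 : ℝ) * A = A2 * (d + 1) := by exact_mod_cast h2
    have g3 : (B1 : ℝ) * (d + 1) = B * (2 * i + 2) := by exact_mod_cast h3
    have g4 : (i + 1 + d + i + 1 : ℝ) * B3 = B1 * (d + 1) := by exact_mod_cast h4
    have g5 : (B2 : ℝ) * (d + 1) = B3 * (2 * i + 1) := by exact_mod_cast h5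
    have hd : (d + 1 : ℝ) ≠ 0 := by positivity
    have hn : (2 * i + d + 2 : ℝ) ≠ 0 := by positivity
    have k1 : (A1 : ℝ) = A * (2 * i + d + 2) / (d + 1) := by rw [eq_div_iff hd, g1]
    have k2 : (A2 : ℝ) = A * (2 * i + 2 * d + 3) / (d + 1) := by
      rw [eq_div_iff hd, ← g2]; ring
    have k3 : (B1 : ℝ) = B * (2 * i + 2) / (d + 1) := by rw [eq_div_iff hd, g3]
    have k4 : (B3 : ℝ) = B * (2 * i + 2) / (2 * i + d + 2) := by
      rw [eq_div_iff hn, ← g3, ← g4]; ring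
    have k5 : (B2 : ℝ) = B * (2 * i + 2) / (2 * i + d + 2) * (2 * i + 1) / (d + 1) := by
      rw [eq_div_iff hd, g5, k4]
    rw [k1, k2, k3, k5]
    push_cast
    simp only [pow_succ]
    generalize ((1 : ℝ) / 4) ^ d = q
    generalize (-1 : ℝ) ^ d = p
    field_simp
    ring
  · unfold aOdd aEven
    simp [Nat.factorial_succ]
    try ring
end

section
/- For every integer m ≥ 1 and every integer i with 1 ≤ i ≤ m, a_{2m,2i} = −((2m)² / (2i)) · a_{2m−1,2i−1}, where a_{2m−1,2i−1} denotes the odd-index coefficient with outer index 2(m−1)+1. -/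
open Finset

theorem aEven_from_aOdd (m : ℕ) (hm : 1 ≤ m) (i : ℕ) (hi1 : 1 ≤ i) (hi2 : i ≤ m) :
    aEven m i = -((2 * (m : ℝ)) ^ 2 / (2 * (i : ℝ))) * aOdd (m - 1) (i - 1) := by
  obtain ⟨j, rfl⟩ : ∃ j, i = j + 1 := ⟨i - 1, by omega⟩
  obtain ⟨k, rfl⟩ : ∃ k, m = j + 1 + k := ⟨m - (j + 1), by omega⟩
  have e1 : j + 1 + k - (j + 1) = k := by omega
  have e2 : j + 1 + k - 1 = j + k := by omega
  have e3 : j + 1 - 1 = j := by omega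
  have e4 : j + k - j = k := by omega
  unfold aEven aOdd
  rw [e1, e2, e3, e4]
  have z : (2 * ((j + 1 : ℕ) : ℤ)) - 2 * ((j + 1 + k : ℕ) : ℤ)
      = 2 * (j : ℤ) - 2 * ((j + k : ℕ) : ℤ) := by push_cast; ring
  rw [z]
  have f : 2 * (j + 1 + k) = (2 * (j + k) + 1) + 1 := by ring
  have g : j + 1 + k + (j + 1) = (j + k + j + 1) + 1 := by ring
  rw [f, g, Nat.factorial_succ (2 * (j + k) + 1)]
  have h1 := Nat.choose_mul_succ_eq (2 * (j + k) + 1) k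
  have h2 := Nat.choose_mul_succ_eq (j + k + j + 1) k
  rw [show 2 * (j + k) + 1 + 1 - k = 2 * j + k + 2 by omega] at h1
  rw [show j + k + j + 1 + 1 - k = 2 * j + 2 by omega] at h2
  have h1' := congrArg (Nat.cast : ℕ → ℝ) h1
  have h2' := congrArg (Nat.cast : ℕ → ℝ) h2
  push_cast at h1' h2' ⊢
  generalize ((Nat.choose (2 * (j + k) + 1 + 1) k : ℕ) : ℝ) = A at *
  generalize ((Nat.choose (2 * (j + k) + 1) k : ℕ) : ℝ) = B at *
  generalize ((Nat.choose (j + k + j + 1 + 1) k : ℕ) : ℝ) = C at *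
  generalize ((Nat.choose (j + k + j + 1) k : ℕ) : ℝ) = D at *
  generalize ((Nat.factorial (2 * (j + k) + 1) : ℕ) : ℝ) = F at *
  generalize (2 : ℝ) ^ (2 * (j : ℤ) - 2 * ((j : ℤ) + (k : ℤ))) = P at *
  have p1 : (2 * (j : ℝ) + k + 2) ≠ 0 := by positivity
  have p2 : (2 * (j : ℝ) + 2) ≠ 0 := by positivity
  have p3 : ((j : ℝ) + 1) ≠ 0 := by positivity
  have hA : A = B * (2 * (j + k) + 1 + 1) / (2 * (j : ℝ) + k + 2) := by
    rw [eq_div_iff p1]; exact h1'.symm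
  have hC : C = D * (j + k + j + 1 + 1) / (2 * (j : ℝ) + 2) := by
    rw [eq_div_iff p2]; exact h2'.symm
  rw [hA, hC, pow_succ]
  have p4 : (2 * (j : ℝ) + 2) = 2 * (j + 1) := by ring
  have p5 : ((j : ℝ) + k + j + 1 + 1) = 2 * (j : ℝ) + k + 2 := by ring
  rw [p4, p5]
  field_simp
  ring
end

section
/- For every integer m ≥ 1, Σ_{i=0}^{m+1} a_{2(m+1),2i} / C(2m+1, m+1−i) = −(2m+2) · Σ_{i=0}^{m} a_{2m+1,2i+1} / C(2m, m−i) + Σ_{i=0}^{m} a_{2m+1,2i+1} / C(2m+1, m−i). -/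
open Finset

lemma F_rec_s13 (n K : ℕ) :
    ∑ k ∈ range (K+1), (-1/4:ℝ)^k * (Nat.choose (n+2-k) k : ℝ) =
    ∑ k ∈ range (K+1), (-1/4:ℝ)^k * (Nat.choose (n+1-k) k : ℝ) +
      (-1/4) * ∑ k ∈ range K, (-1/4:ℝ)^k * (Nat.choose (n-k) k : ℝ) := by
  rw [Finset.sum_range_succ', Finset.sum_range_succ' _ K, Finset.mul_sum]
  rw [add_right_comm, ← Finset.sum_add_distrib]
  congr 1
  · apply Finset.sum_congr rfl
    intro k _
    have h : Nat.choose (n+2-(k+1)) (k+1) = Nat.choose (n-k) k + Nat.choose (n+1-(k+1)) (k+1) := by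
      rcases le_or_gt k n with h | h
      · rw [show n+2-(k+1) = (n-k)+1 by omega, show n+1-(k+1) = n-k by omega,
          Nat.choose_succ_succ]
      · rw [show n+2-(k+1) = 0 by omega, show n+1-(k+1) = 0 by omega, show n-k = 0 by omega]
        rw [Nat.choose_eq_zero_of_lt (by omega), Nat.choose_eq_zero_of_lt (by omega)]
    rw [h]
    push_cast
    ring

lemma F_eq : ∀ (n K : ℕ), n < 2*K →
    ∑ k ∈ range K, (-1/4:ℝ)^k * (Nat.choose (n-k) k : ℝ) = (n+1)/2^n
  | 0, K, h => by
    obtain ⟨K, rfl⟩ : ∃ j, K = j+1 := ⟨K-1, by omega⟩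
    rw [Finset.sum_range_succ']
    simp
  | 1, K, h => by
    obtain ⟨K, rfl⟩ : ∃ j, K = j+1 := ⟨K-1, by omega⟩
    rw [Finset.sum_range_succ']
    simp
  | n+2, K, h => by
    obtain ⟨K, rfl⟩ : ∃ j, K = j+1 := ⟨K-1, by omega⟩
    rw [F_rec_s13, F_eq (n+1) (K+1) (by omega), F_eq n K (by omega)]
    push_cast
    field_simp
    ring

lemma L_term (n k : ℕ) (hk : 2*k ≤ n+1) :
    (Nat.choose (n+1) k : ℝ) / (Nat.choose n k : ℝ) * (Nat.choose (n+1-k) k : ℝ)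
      = 2 * (Nat.choose (n+1-k) k : ℝ) - (Nat.choose (n-k) k : ℝ) := by
  have hkn : k ≤ n := by omega
  obtain ⟨j, rfl⟩ := Nat.exists_eq_add_of_le hkn
  have e1 : k + j + 1 - k = j + 1 := by omega
  have e2 : k + j - k = j := by omega
  rw [e1, e2]
  have h0 : (Nat.choose (k+j) k : ℝ) ≠ 0 := by
    exact_mod_cast (Nat.choose_pos hkn).ne'
  have h1 := Nat.choose_mul_succ_eq (k+j) k
  have h2 := Nat.choose_mul_succ_eq j k
  rw [e1] at h1
  have h1' : (Nat.choose (k+j) k : ℝ) * (k+j+1) = Nat.choose (k+j+1) k * (j+1) := by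
    exact_mod_cast h1
  have h2' : (Nat.choose j k : ℝ) * (j+1) = Nat.choose (j+1) k * (j+1-k) := by
    have : ((j+1-k : ℕ):ℝ) = (j:ℝ)+1-k := by
      rw [Nat.cast_sub (by omega)]; push_cast; ring
    rw [← this]
    exact_mod_cast h2
  have hj : (j:ℝ)+1 ≠ 0 := by positivity
  have h3 : (Nat.choose (k+j+1) k : ℝ) / (Nat.choose (k+j) k : ℝ) = (k+j+1)/(j+1) := by
    field_simp
    linarith
  rw [h3]
  field_simp
  linarith

lemma L_eq (n K : ℕ) (h : n + 1 < 2*K) (h' : 2 * K ≤ n+3) :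
    ∑ k ∈ range K, (-1/4:ℝ)^k * ((Nat.choose (n+1) k : ℝ) / (Nat.choose n k : ℝ)
      * (Nat.choose (n+1-k) k : ℝ)) = 1/2^n := by
  have : ∀ k ∈ range K, (-1/4:ℝ)^k * ((Nat.choose (n+1) k : ℝ) / (Nat.choose n k : ℝ)
      * (Nat.choose (n+1-k) k : ℝ)) = 2 * ((-1/4:ℝ)^k * (Nat.choose (n+1-k) k : ℝ))
        - (-1/4:ℝ)^k * (Nat.choose (n-k) k : ℝ) := by
    intro k hk
    rw [Finset.mem_range] at hk
    rw [L_term n k (by omega)]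
    ring
  rw [Finset.sum_congr rfl this, Finset.sum_sub_distrib, ← Finset.mul_sum,
    F_eq (n+1) K h, F_eq n K (by omega)]
  push_cast
  field_simp
  ring

lemma pow_aux (m k : ℕ) (hk : k ≤ m) :
    (-1 : ℝ) ^ k * (2 : ℝ) ^ ((2 * ((m - k : ℕ) : ℤ)) - 2 * (m : ℤ)) = (-1/4:ℝ)^k := by
  have : (2 * ((m - k : ℕ) : ℤ)) - 2 * (m : ℤ) = (-2) * (k : ℤ) := by
    push_cast [hk]; ring
  rw [this, zpow_mul, zpow_natCast, ← mul_pow]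
  norm_num

lemma aEven_flip (m k : ℕ) (hk : k ≤ m) : aEven m (m - k) =
    (-1/4:ℝ)^k * (Nat.factorial (2*m) : ℝ) * (Nat.choose (2*m) k : ℝ)
      * (Nat.choose (2*m-k) k : ℝ) := by
  unfold aEven
  rw [← pow_aux m k hk, show m - (m-k) = k by omega, show m + (m-k) = 2*m-k by omega]

lemma aOdd_flip (m k : ℕ) (hk : k ≤ m) : aOdd m (m - k) =
    -((-1/4:ℝ)^k * (Nat.factorial (2*m+1) : ℝ) * (Nat.choose (2*m+1) k : ℝ)
      * (Nat.choose (2*m+1-k) k : ℝ)) := by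
  unfold aOdd
  rw [← pow_aux m k hk, show m - (m-k) = k by omega, show m + (m-k) + 1 = 2*m+1-k by omega]
  ring

theorem sum_aEven_succ_div_choose_eq (m : ℕ) (hm : 1 ≤ m) :
    ∑ i ∈ Finset.range (m + 2), aEven (m + 1) i / (Nat.choose (2 * m + 1) (m + 1 - i) : ℝ) =
      -(2 * (m : ℝ) + 2) * ∑ i ∈ Finset.range (m + 1), aOdd m i / (Nat.choose (2 * m) (m - i) : ℝ) +
        ∑ i ∈ Finset.range (m + 1), aOdd m i / (Nat.choose (2 * m + 1) (m - i) : ℝ) := by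
  have A : ∑ i ∈ Finset.range (m + 2), aEven (m + 1) i / (Nat.choose (2 * m + 1) (m + 1 - i) : ℝ)
      = (Nat.factorial (2*m+2) : ℝ) * (1/2^(2*m+1)) := by
    rw [← L_eq (2*m+1) (m+2) (by omega) (by omega), Finset.mul_sum, ← Finset.sum_flip]
    apply Finset.sum_congr rfl
    intro k hk
    rw [Finset.mem_range] at hk
    rw [aEven_flip (m+1) k (by omega), show m+1-(m+1-k) = k by omega,
      show 2*(m+1) = 2*m+1+1 by ring]
    ring
  have B : ∑ i ∈ Finset.range (m + 1), aOdd m i / (Nat.choose (2 * m) (m - i) : ℝ)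
      = -(Nat.factorial (2*m+1) : ℝ) * (1/2^(2*m)) := by
    rw [← L_eq (2*m) (m+1) (by omega) (by omega), Finset.mul_sum, ← Finset.sum_flip]
    apply Finset.sum_congr rfl
    intro k hk
    rw [Finset.mem_range] at hk
    rw [aOdd_flip m k (by omega), show m-(m-k) = k by omega]
    ring
  have C : ∑ i ∈ Finset.range (m + 1), aOdd m i / (Nat.choose (2 * m + 1) (m - i) : ℝ)
      = -(Nat.factorial (2*m+1) : ℝ) * (((2*m+1:ℕ)+1)/2^(2*m+1)) := by
    rw [← F_eq (2*m+1) (m+1) (by omega), Finset.mul_sum, ← Finset.sum_flip]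
    apply Finset.sum_congr rfl
    intro k hk
    rw [Finset.mem_range] at hk
    rw [aOdd_flip m k (by omega), show m-(m-k) = k by omega]
    have h0 : (Nat.choose (2*m+1) k : ℝ) ≠ 0 := by
      exact_mod_cast (Nat.choose_pos (by omega)).ne'
    field_simp
  rw [A, B, C, show 2*m+2 = (2*m+1)+1 by ring, Nat.factorial_succ (2*m+1)]
  push_cast
  field_simp
  ring
end

section
/- For every integer m ≥ 1, Σ_{i=0}^{m} a_{2m+1,2i+1} / C(2m+1, m−i) = (1/(2m+2)) · Σ_{i=0}^{m+1} a_{2(m+1),2i} / C(2m+1, m+1−i) − (1/(2m+2)) · Σ_{i=0}^{m+1} 2 · a_{2(m+1),2i} / C(2m+2, m+1−i). -/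
open Finset

lemma term_zero (m : ℕ) :
    aEven (m + 1) 0 / (Nat.choose (2 * m + 1) (m + 1 - 0) : ℝ) =
      2 * aEven (m + 1) 0 / (Nat.choose (2 * m + 2) (m + 1 - 0) : ℝ) := by
  have h := Nat.choose_mul_succ_eq (2 * m + 1) (m + 1)
  have e : 2 * m + 1 + 1 - (m + 1) = m + 1 := by omega
  rw [e] at h
  have h2 : (2 * m + 2).choose (m + 1) = 2 * (2 * m + 1).choose (m + 1) := by
    apply Nat.eq_of_mul_eq_mul_right (Nat.succ_pos m)
    rw [Nat.succ_eq_add_one, ← h]; ring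
  have hA : ((2 * m + 1).choose (m + 1) : ℝ) ≠ 0 := by
    exact_mod_cast (Nat.choose_pos (by omega)).ne'
  rw [Nat.sub_zero, h2]
  push_cast
  field_simp

lemma term_succ (i j : ℕ) :
    aOdd (i + j) i / (Nat.choose (2 * (i + j) + 1) (i + j - i) : ℝ) =
      (1 / (2 * ((i + j : ℕ) : ℝ) + 2)) *
        (aEven (i + j + 1) (i + 1) / (Nat.choose (2 * (i + j) + 1) (i + j + 1 - (i + 1)) : ℝ)) -
      (1 / (2 * ((i + j : ℕ) : ℝ) + 2)) *
        (2 * aEven (i + j + 1) (i + 1) /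
          (Nat.choose (2 * (i + j) + 2) (i + j + 1 - (i + 1)) : ℝ)) := by
  have e1 : i + j - i = j := by omega
  have e2 : i + j + 1 - (i + 1) = j := by omega
  have e3 : 2 * (i + j + 1) = 2 * (i + j) + 2 := by ring
  have e4 : i + j + 1 + (i + 1) = 2 * i + j + 2 := by ring
  have e5 : i + j + i + 1 = 2 * i + j + 1 := by ring
  have e6 : (2 * ((i + 1 : ℕ) : ℤ)) - 2 * ((i + j + 1 : ℕ) : ℤ)
      = (2 * (i : ℤ)) - 2 * ((i + j : ℕ) : ℤ) := by push_cast; ring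
  unfold aOdd aEven
  rw [e6, e1, e2, e3, e4, e5]
  have h1 := Nat.choose_mul_succ_eq (2 * (i + j) + 1) j
  have h2 := Nat.choose_mul_succ_eq (2 * i + j + 1) j
  rw [show 2 * (i + j) + 1 + 1 - j = 2 * i + j + 2 by omega] at h1
  rw [show 2 * i + j + 1 + 1 - j = 2 * i + 2 by omega] at h2
  have hA : ((2 * (i + j) + 1).choose j : ℝ) ≠ 0 := by
    exact_mod_cast (Nat.choose_pos (by omega)).ne'
  have hB : ((2 * (i + j) + 2).choose j : ℝ) ≠ 0 := by
    exact_mod_cast (Nat.choose_pos (by omega)).ne'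
  have hf : ((2 * (i + j) + 2).factorial : ℝ)
      = (2 * ((i + j : ℕ) : ℝ) + 2) * ((2 * (i + j) + 1).factorial : ℝ) := by
    rw [Nat.factorial_succ (2 * (i + j) + 1)]; push_cast; ring
  rw [hf]
  replace h1 : ((2 * (i + j) + 1).choose j : ℝ) * (2 * ((i + j : ℕ) : ℝ) + 2)
      = ((2 * (i + j) + 2).choose j : ℝ) * (2 * i + j + 2) := by
    have := congrArg (Nat.cast : ℕ → ℝ) h1
    push_cast at this ⊢
    linarith
  replace h2 : ((2 * i + j + 1).choose j : ℝ) * (2 * i + j + 2)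
      = ((2 * i + j + 2).choose j : ℝ) * (2 * i + 2) := by
    have := congrArg (Nat.cast : ℕ → ℝ) h2
    push_cast at this ⊢
    linarith
  have hM : (2 * ((i + j : ℕ) : ℝ) + 2) ≠ 0 := by positivity
  have hN : (2 * (i : ℝ) + j + 2) ≠ 0 := by positivity
  have hMe : (2 * ((i + j : ℕ) : ℝ) + 2) = 2 * i + 2 * j + 2 := by push_cast; ring
  generalize ((2 * (i + j) + 1).choose j : ℝ) = A at *
  generalize ((2 * (i + j) + 2).choose j : ℝ) = B at *
  generalize ((2 * i + j + 1).choose j : ℝ) = C at *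
  generalize ((2 * i + j + 2).choose j : ℝ) = D at *
  generalize (2 : ℝ) ^ ((2 * (i : ℤ)) - 2 * ((i + j : ℕ) : ℤ)) = P at *
  generalize ((2 * (i + j) + 1).factorial : ℝ) = F at *
  generalize (2 * ((i + j : ℕ) : ℝ) + 2) = M at *
  have hAe : B = A * M / (2 * i + j + 2) := by field_simp; linarith
  have hC : C = D * (2 * i + 2) / (2 * i + j + 2) := by field_simp; linarith
  rw [hAe, hC, pow_succ]
  field_simp
  rw [hMe]
  ring

theorem sum_aOdd_div_choose_eq (m : ℕ) (hm : 1 ≤ m) :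
    ∑ i ∈ Finset.range (m + 1), aOdd m i / (Nat.choose (2 * m + 1) (m - i) : ℝ) =
      (1 / (2 * (m : ℝ) + 2)) *
          ∑ i ∈ Finset.range (m + 2), aEven (m + 1) i / (Nat.choose (2 * m + 1) (m + 1 - i) : ℝ) -
        (1 / (2 * (m : ℝ) + 2)) *
          ∑ i ∈ Finset.range (m + 2), 2 * aEven (m + 1) i / (Nat.choose (2 * m + 2) (m + 1 - i) : ℝ) := by
  rw [Finset.sum_range_succ' _ (m + 1), Finset.sum_range_succ' _ (m + 1), term_zero, mul_add, mul_add,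
    add_sub_add_right_eq_sub, Finset.mul_sum, Finset.mul_sum, ← Finset.sum_sub_distrib]
  apply Finset.sum_congr rfl
  intro i hi
  obtain ⟨j, rfl⟩ := Nat.exists_eq_add_of_le (Nat.lt_succ_iff.mp (Finset.mem_range.mp hi))
  exact term_succ i j
end

section
/- For every integer m ≥ 1 and every integer i with 0 ≤ i ≤ m, Σ_{l=0}^{m−i} (−1)^l · C(m−i, l) / (m + i + l) = 1 / (2m · C(2m−1, m−i)), where the sums and quotients are taken in the real numbers. -/
open Finset

theorem aux_pascal (n : ℕ) (f : ℕ → ℝ) :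
    ∑ l ∈ Finset.range (n + 2), (-1 : ℝ) ^ l * (Nat.choose (n + 1) l : ℝ) * f l =
      ∑ l ∈ Finset.range (n + 1), (-1 : ℝ) ^ l * (Nat.choose n l : ℝ) * f l -
      ∑ l ∈ Finset.range (n + 1), (-1 : ℝ) ^ l * (Nat.choose n l : ℝ) * f (l + 1) := by
  have h : ∑ l ∈ Finset.range (n + 2), (-1 : ℝ) ^ l * (Nat.choose n l : ℝ) * f l =
      ∑ l ∈ Finset.range (n + 1), (-1 : ℝ) ^ l * (Nat.choose n l : ℝ) * f l := by
    rw [Finset.sum_range_succ]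
    simp
  rw [← h, Finset.sum_range_succ', Finset.sum_range_succ' _ (n + 1), add_sub_right_comm,
    ← Finset.sum_sub_distrib]
  congr 1
  · apply Finset.sum_congr rfl
    intro l _
    rw [Nat.choose_succ_succ]
    push_cast
    ring
  · simp

theorem aux_sum (n : ℕ) : ∀ a : ℕ,
    ∑ l ∈ Finset.range (n + 1), (-1 : ℝ) ^ l * (Nat.choose n l : ℝ) * ((a : ℝ) + 1 + l)⁻¹ =
      (n.factorial : ℝ) * a.factorial / (n + a + 1).factorial := by
  induction n with
  | zero =>
    intro a
    have : (a.factorial : ℝ) ≠ 0 := by positivity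
    have : (a : ℝ) + 1 ≠ 0 := by positivity
    simp [Nat.factorial_succ]
    field_simp
  | succ n ih =>
    intro a
    have h2 := ih (a + 1)
    rw [aux_pascal n (fun l => ((a : ℝ) + 1 + l)⁻¹), ih a]
    have e : ∑ l ∈ Finset.range (n + 1),
        (-1 : ℝ) ^ l * (Nat.choose n l : ℝ) * ((a : ℝ) + 1 + ((l + 1 : ℕ) : ℝ))⁻¹ =
        (n.factorial : ℝ) * (a + 1).factorial / (n + (a + 1) + 1).factorial := by
      rw [← h2]
      apply Finset.sum_congr rfl
      intro l _
      push_cast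
      congr 2
      ring
    rw [e, show n + (a + 1) + 1 = (n + a + 1) + 1 by ring,
      show n + 1 + a + 1 = (n + a + 1) + 1 by ring, Nat.factorial_succ (n + a + 1),
      Nat.factorial_succ a, Nat.factorial_succ n]
    have : ((n + a + 1).factorial : ℝ) ≠ 0 := by positivity
    have : (n : ℝ) + a + 1 + 1 ≠ 0 := by positivity
    push_cast
    field_simp
    ring

theorem alternating_sum_choose_div (m i : ℕ) (hm : 1 ≤ m) (hi : i ≤ m) :
    ∑ l ∈ Finset.range (m - i + 1),
        (-1 : ℝ) ^ l * (Nat.choose (m - i) l : ℝ) / ((m : ℝ) + i + l) =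
      1 / (2 * (m : ℝ) * (Nat.choose (2 * m - 1) (m - i) : ℝ)) := by
  obtain ⟨a, ha⟩ : ∃ a, m + i = a + 1 := ⟨m + i - 1, by omega⟩
  obtain ⟨n, hn⟩ : ∃ n, m - i = n := ⟨_, rfl⟩
  have h1 : 2 * m - 1 = n + a := by omega
  have h2 : 2 * (m : ℝ) = n + a + 1 := by
    have : 2 * m = n + a + 1 := by omega
    exact_mod_cast this
  have h3 : (m : ℝ) + i = a + 1 := by exact_mod_cast ha
  rw [hn, h1, h2, h3]
  simp only [div_eq_mul_inv _ ((a : ℝ) + 1 + _)]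
  rw [aux_sum, Nat.factorial_succ, Nat.cast_add_choose]
  have : (n.factorial : ℝ) ≠ 0 := by positivity
  have : (a.factorial : ℝ) ≠ 0 := by positivity
  have : ((n + a).factorial : ℝ) ≠ 0 := by positivity
  have : (n : ℝ) + a + 1 ≠ 0 := by positivity
  push_cast
  field_simp
end

section
/- For every pair of integers m ≥ 1 and 0 ≤ i ≤ m, there exists a constant C > 0 such that for every natural number j ≥ 1, | ∫_0^1 ∫_0^1 (y + 1/j)^{2i} · r^{m−i} · y^{2m−1} / ((y + 1/j)² + r)^{2m+1} dr dy − (1/(2m · C(2m−1, m−i))) · ln j | ≤ C, where the double integral is over (y, r) ∈ (0,1) × (0,1) and C(n,k) denotes the binomial coefficient. -/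
open Finset

lemma aux_inner (p : ℕ) : ∀ k : ℕ, ∃ E : ℝ → ℝ, ContinuousOn E (Set.Ioi 0) ∧
    ∀ a : ℝ, 0 < a → |E a| ≤ 1 ∧
      ∫ r in (0:ℝ)..1, r ^ k / (a + r) ^ (k + p + 2) =
        ((k.factorial * p.factorial : ℝ) / ((k + p + 1).factorial : ℝ)) / a ^ (p + 1) + E a := by
  have key : ∀ (N : ℕ) (a r : ℝ), 0 < a → 0 ≤ r →
      HasDerivAt (fun r : ℝ => -1 / ((N + 1 : ℝ) * (a + r) ^ (N + 1))) (1 / (a + r) ^ (N + 2)) r := by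
    intro N a r ha hr
    have hp : 0 < a + r := by linarith
    have h1 : HasDerivAt (fun r : ℝ => (N + 1 : ℝ) * (a + r) ^ (N + 1))
        ((N + 1 : ℝ) * (((N + 1 : ℕ) : ℝ) * (a + r) ^ N * 1)) r := by
      have := (((hasDerivAt_id r).const_add a).pow (N + 1)).const_mul (N + 1 : ℝ)
      simpa using this
    have hne : (N + 1 : ℝ) * (a + r) ^ (N + 1) ≠ 0 := by positivity
    have h2 := (hasDerivAt_const r (-1 : ℝ)).div h1 hne
    refine h2.congr_deriv ?_
    push_cast
    field_simp
    ring
  intro k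
  induction k with
  | zero =>
    refine ⟨fun a => -1 / ((p + 1 : ℝ) * (a + 1) ^ (p + 1)), ?_, ?_⟩
    · intro a ha
      have ha : 0 < a := ha
      apply ContinuousAt.continuousWithinAt
      refine ContinuousAt.div (by fun_prop) (by fun_prop) ?_
      positivity
    · intro a ha
      constructor
      · rw [abs_div, abs_neg, abs_one, abs_of_pos (by positivity)]
        rw [div_le_one (by positivity)]
        have : (1:ℝ) ≤ (a + 1) ^ (p + 1) := one_le_pow₀ (by linarith)
        have h0 : (0:ℝ) ≤ p := by positivity
        nlinarith
      · have hI : ∫ r in (0:ℝ)..1, 1 / (a + r) ^ (p + 2) =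
            -1 / ((p + 1 : ℝ) * (a + 1) ^ (p + 1)) - -1 / ((p + 1 : ℝ) * (a + 0) ^ (p + 1)) := by
          apply intervalIntegral.integral_eq_sub_of_hasDerivAt
            (f := fun r : ℝ => -1 / ((p + 1 : ℝ) * (a + r) ^ (p + 1)))
          · intro x hx
            rw [Set.uIcc_of_le zero_le_one] at hx
            exact key p a x ha hx.1
          · apply ContinuousOn.intervalIntegrable
            intro x hx
            rw [Set.uIcc_of_le zero_le_one] at hx
            have : 0 < a + x := by linarith [hx.1]
            apply ContinuousAt.continuousWithinAt
            refine ContinuousAt.div (by fun_prop) (by fun_prop) (by positivity)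
        simp only [pow_zero, Nat.zero_add]
        rw [hI, Nat.factorial_succ]
        have : (p.factorial : ℝ) ≠ 0 := by positivity
        push_cast
        simp only [add_zero, Nat.factorial_zero, Nat.cast_one]
        field_simp
        ring
  | succ k ih =>
    obtain ⟨E, hE, hE2⟩ := ih
    have hcast : (k + 1 + p + 2 : ℕ) = (k + p + 1) + 2 := by ring
    refine ⟨fun a => -1 / (((k + p + 1 : ℕ) + 1 : ℝ) * (a + 1) ^ (k + p + 1 + 1)) +
      ((k + 1 : ℝ) / ((k + p + 1 : ℕ) + 1 : ℝ)) * E a, ?_, ?_⟩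
    · refine ContinuousOn.add ?_ (continuousOn_const.mul hE)
      intro a ha
      have ha : 0 < a := ha
      apply ContinuousAt.continuousWithinAt
      refine ContinuousAt.div (by fun_prop) (by fun_prop) ?_
      positivity
    · intro a ha
      obtain ⟨hb, hI⟩ := hE2 a ha
      constructor
      · refine (abs_add_le _ _).trans ?_
        rw [abs_div, abs_neg, abs_one, abs_of_pos (by positivity), abs_mul,
          abs_of_pos (by positivity : (0:ℝ) < (k + 1 : ℝ) / ((k + p + 1 : ℕ) + 1 : ℝ))]
        have h1 : (1:ℝ) ≤ (a + 1) ^ (k + p + 1 + 1) := one_le_pow₀ (by linarith)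
        have hN : (0:ℝ) < ((k + p + 1 : ℕ) + 1 : ℝ) := by positivity
        calc _ ≤ 1 / (((k + p + 1 : ℕ) + 1 : ℝ) * 1) +
              (k + 1 : ℝ) / ((k + p + 1 : ℕ) + 1 : ℝ) * 1 := by gcongr
          _ = (k + 2 : ℝ) / ((k + p + 1 : ℕ) + 1 : ℝ) := by field_simp; ring
          _ ≤ 1 := by
            rw [div_le_one hN]
            push_cast
            have h0 : (0:ℝ) ≤ p := by positivity
            linarith
      · have hI2 : ∫ r in (0:ℝ)..1, r ^ (k + 1) * (1 / (a + r) ^ (k + p + 1 + 2)) = _ :=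
          intervalIntegral.integral_mul_deriv_eq_deriv_mul
            (u := fun r : ℝ => r ^ (k + 1)) (u' := fun r : ℝ => ((k + 1 : ℕ) : ℝ) * r ^ k)
            (v := fun r : ℝ => -1 / (((k + p + 1 : ℕ) + 1 : ℝ) * (a + r) ^ (k + p + 1 + 1)))
            (v' := fun r : ℝ => 1 / (a + r) ^ (k + p + 1 + 2))
            (fun x _ => by simpa using hasDerivAt_pow (k + 1) x)
            (fun x hx => by
              rw [Set.uIcc_of_le zero_le_one] at hx
              exact key (k + p + 1) a x ha hx.1)
            (Continuous.intervalIntegrable (by fun_prop) _ _)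
            (by
              apply ContinuousOn.intervalIntegrable
              intro x hx
              rw [Set.uIcc_of_le zero_le_one] at hx
              have : 0 < a + x := by linarith [hx.1]
              apply ContinuousAt.continuousWithinAt
              refine ContinuousAt.div (by fun_prop) (by fun_prop) (by positivity))
        have hI3 : ∫ r in (0:ℝ)..1, ((k + 1 : ℕ) : ℝ) * r ^ k *
            (-1 / (((k + p + 1 : ℕ) + 1 : ℝ) * (a + r) ^ (k + p + 1 + 1))) =
            -((k + 1 : ℝ) / ((k + p + 1 : ℕ) + 1 : ℝ)) *
              ∫ r in (0:ℝ)..1, r ^ k / (a + r) ^ (k + p + 2) := by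
          rw [← intervalIntegral.integral_const_mul]
          congr 1
          ext r
          push_cast
          rw [show k + p + 1 + 1 = k + p + 2 by ring, div_eq_mul_inv, mul_inv, div_eq_mul_inv,
            div_eq_mul_inv]
          ring
        rw [hI3, hI] at hI2
        have hL : ∫ r in (0:ℝ)..1, r ^ (k + 1) / (a + r) ^ (k + 1 + p + 2) =
            ∫ r in (0:ℝ)..1, r ^ (k + 1) * (1 / (a + r) ^ (k + p + 1 + 2)) := by
          rw [hcast]
          congr 1
          ext r
          ring
        rw [hL, hI2, show k + 1 + p + 1 = (k + p + 1) + 1 by ring, Nat.factorial_succ (k + p + 1),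
          Nat.factorial_succ k]
        have : ((k + p + 1).factorial : ℝ) ≠ 0 := by positivity
        have hN : ((k + p + 1 : ℕ) + 1 : ℝ) ≠ 0 := by positivity
        push_cast at hN ⊢
        simp only [one_pow, ne_eq, Nat.add_eq_zero_iff, one_ne_zero, and_false, not_false_eq_true,
          zero_pow, zero_mul, sub_zero]
        field_simp
        ring

theorem log_asymptotics_of_singular_integral (m i : ℕ) (hm : 1 ≤ m) (hi : i ≤ m) :
    ∃ C > 0, ∀ j : ℕ, 1 ≤ j →
      |(∫ y in Set.Ioo (0 : ℝ) 1, ∫ r in Set.Ioo (0 : ℝ) 1,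
            (y + 1 / (j : ℝ)) ^ (2 * i) * r ^ (m - i) * y ^ (2 * m - 1) /
              ((y + 1 / (j : ℝ)) ^ 2 + r) ^ (2 * m + 1)) -
          (1 / (2 * (m : ℝ) * (Nat.choose (2 * m - 1) (m - i) : ℝ))) * Real.log j| ≤ C := by
  obtain ⟨E, hE, hE2⟩ := aux_inner (m + i - 1) (m - i)
  set c : ℝ := 1 / (2 * (m : ℝ) * (Nat.choose (2 * m - 1) (m - i) : ℝ)) with hc
  have hc0 : 0 < c := by
    have h1 : 0 < Nat.choose (2 * m - 1) (m - i) := Nat.choose_pos (by omega)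
    have h2 : (0:ℝ) < m := by exact_mod_cast hm
    have h3 : (0:ℝ) < (Nat.choose (2 * m - 1) (m - i) : ℝ) := by exact_mod_cast h1
    positivity
  have hceq : (((m - i).factorial * (m + i - 1).factorial : ℝ) /
      ((m - i + (m + i - 1) + 1).factorial : ℝ)) = c := by
    have h1 := Nat.choose_mul_factorial_mul_factorial (n := 2 * m - 1) (k := m - i) (by omega)
    rw [show 2 * m - 1 - (m - i) = m + i - 1 by omega] at h1
    have h2 : (m - i + (m + i - 1) + 1).factorial = (2 * m) * (2 * m - 1).factorial := by
      rw [show m - i + (m + i - 1) + 1 = (2 * m - 1) + 1 by omega, Nat.factorial_succ]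
      congr 1
      omega
    rw [h2, ← h1, hc]
    have h3 : 0 < Nat.choose (2 * m - 1) (m - i) := Nat.choose_pos (by omega)
    have h4 : ((Nat.choose (2 * m - 1) (m - i) : ℕ) : ℝ) ≠ 0 := by positivity
    have h5 : ((m - i).factorial : ℝ) ≠ 0 := by positivity
    have h6 : ((m + i - 1).factorial : ℝ) ≠ 0 := by positivity
    have h7 : (m : ℝ) ≠ 0 := by positivity
    push_cast
    field_simp
  rw [hceq] at hE2
  set n := 2 * m - 1 with hn
  refine ⟨2 ^ (2 * i) + c * n + c, by positivity, ?_⟩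
  intro j hj
  have hj0 : (1:ℝ) ≤ j := by exact_mod_cast hj
  set e : ℝ := 1 / (j : ℝ) with he
  have he0 : 0 < e := by positivity
  have he1 : e ≤ 1 := by rw [he, div_le_one (by positivity)]; exact hj0
  -- the inner integral
  have hinner : ∀ y ∈ Set.Ioo (0:ℝ) 1, (∫ r in Set.Ioo (0 : ℝ) 1,
      (y + e) ^ (2 * i) * r ^ (m - i) * y ^ n / ((y + e) ^ 2 + r) ^ (2 * m + 1)) =
      c * (y ^ n / (y + e) ^ (n + 1)) + (y + e) ^ (2 * i) * y ^ n * E ((y + e) ^ 2) := by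
    intro y hy
    have hs : 0 < y + e := by linarith [hy.1]
    have h1 := (hE2 ((y + e) ^ 2) (by positivity)).2
    rw [← MeasureTheory.integral_Ioc_eq_integral_Ioo, ← intervalIntegral.integral_of_le zero_le_one]
    have h2 : ∀ r : ℝ, (y + e) ^ (2 * i) * r ^ (m - i) * y ^ n / ((y + e) ^ 2 + r) ^ (2 * m + 1) =
        ((y + e) ^ (2 * i) * y ^ n) *
          (r ^ (m - i) / ((y + e) ^ 2 + r) ^ (m - i + (m + i - 1) + 2)) := by
      intro r
      rw [show m - i + (m + i - 1) + 2 = 2 * m + 1 by omega]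
      ring
    simp_rw [h2]
    rw [intervalIntegral.integral_const_mul, h1, show m + i - 1 + 1 = m + i by omega, ← pow_mul,
      show 2 * (m + i) = 2 * i + (n + 1) by omega, pow_add (y + e) (2 * i) (n + 1)]
    field_simp
  rw [MeasureTheory.setIntegral_congr_fun measurableSet_Ioo hinner,
    ← MeasureTheory.integral_Ioc_eq_integral_Ioo, ← intervalIntegral.integral_of_le zero_le_one]
  have hsub : ∀ x ∈ Set.uIcc (0:ℝ) 1, 0 ≤ x ∧ x ≤ 1 ∧ 0 < x + e := by
    intro x hx
    rw [Set.uIcc_of_le zero_le_one] at hx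
    exact ⟨hx.1, hx.2, by linarith [hx.1]⟩
  set G : ℝ → ℝ := fun y => c * (y ^ n / (y + e) ^ (n + 1)) +
    (y + e) ^ (2 * i) * y ^ n * E ((y + e) ^ 2) with hG
  have hGi : IntervalIntegrable G MeasureTheory.volume 0 1 := by
    apply ContinuousOn.intervalIntegrable
    refine ContinuousOn.add ?_ ?_
    · refine continuousOn_const.mul (ContinuousOn.div (by fun_prop) (by fun_prop) ?_)
      intro x hx
      have := (hsub x hx).2.2
      positivity
    · refine ContinuousOn.mul (by fun_prop) ?_
      refine hE.comp (by fun_prop) ?_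
      intro x hx
      have := (hsub x hx).2.2
      exact pow_pos this 2
  have hi1 : IntervalIntegrable (fun y : ℝ => c * (1 / (y + e))) MeasureTheory.volume 0 1 := by
    apply ContinuousOn.intervalIntegrable
    refine continuousOn_const.mul (ContinuousOn.div (by fun_prop) (by fun_prop) ?_)
    intro x hx
    exact (hsub x hx).2.2.ne'
  have hi2 : IntervalIntegrable (fun y : ℝ => e / (y + e) ^ 2) MeasureTheory.volume 0 1 := by
    apply ContinuousOn.intervalIntegrable
    refine (ContinuousOn.div (by fun_prop) (by fun_prop) ?_)
    intro x hx
    exact (pow_pos (hsub x hx).2.2 2).ne'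
  have hI1 : ∫ y in (0:ℝ)..1, c * (1 / (y + e)) = c * Real.log (1 + e) + c * Real.log j := by
    rw [intervalIntegral.integral_eq_sub_of_hasDerivAt (f := fun y => c * Real.log (y + e))
      (f' := fun y => c * (1 / (y + e)))
      (fun x hx => (((hasDerivAt_id x).add_const e).log (hsub x hx).2.2.ne').const_mul c) hi1]
    have : Real.log (0 + e) = - Real.log j := by
      rw [zero_add, he, one_div, Real.log_inv]
    rw [this]; ring
  have hI2 : ∫ y in (0:ℝ)..1, e / (y + e) ^ 2 ≤ 1 := by
    rw [intervalIntegral.integral_eq_sub_of_hasDerivAt (f := fun y => - e / (y + e))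
      (fun x hx => by
        have h := (hsub x hx).2.2
        refine ((hasDerivAt_const x (-e)).div ((hasDerivAt_id x).add_const e) h.ne').congr_deriv ?_
        simp) hi2]
    have h1 : -e / (0 + e) = -1 := by field_simp; ring
    have h2 : -e / (1 + e) ≤ 0 := by
      apply div_nonpos_of_nonpos_of_nonneg <;> linarith
    linarith
  have hpt : ∀ y ∈ Set.Ioc (0:ℝ) 1, ‖G y - c * (1 / (y + e))‖ ≤
      2 ^ (2 * i) + (c * n) * (e / (y + e) ^ 2) := by
    intro y hy
    have hs : 0 < y + e := by linarith [hy.1]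
    have hy0 := hy.1.le
    have hEb := (hE2 ((y + e) ^ 2) (by positivity)).1
    have hq0 : 0 ≤ y / (y + e) := by positivity
    have hq1 : y / (y + e) ≤ 1 := by rw [div_le_one hs]; linarith
    have hb := one_add_mul_le_pow (a := y / (y + e) - 1) (by linarith) n
    have hle : (y / (y + e)) ^ n ≤ 1 := pow_le_one₀ hq0 hq1
    have heq : y / (y + e) - 1 = - (e / (y + e)) := by field_simp; ring
    rw [add_sub_cancel, heq] at hb
    have hA : G y - c * (1 / (y + e)) = (y + e) ^ (2 * i) * y ^ n * E ((y + e) ^ 2) +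
        - (c * ((1 - (y / (y + e)) ^ n) * (1 / (y + e)))) := by
      rw [hG]
      simp only [div_pow]
      field_simp
      ring
    rw [hA]
    refine (norm_add_le _ _).trans (add_le_add ?_ ?_)
    · rw [Real.norm_eq_abs, abs_mul, abs_of_nonneg (by positivity)]
      calc _ ≤ (2:ℝ) ^ (2 * i) * 1 ^ n * 1 := by
            gcongr
            · linarith [hy.2]
            · exact hy.2
        _ = _ := by ring
    · rw [norm_neg, Real.norm_eq_abs, abs_of_nonneg (by
        have : 0 ≤ 1 - (y / (y + e)) ^ n := by linarith
        positivity)]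
      calc _ ≤ c * ((n * (e / (y + e))) * (1 / (y + e))) := by
            gcongr
            linarith
        _ = _ := by field_simp
  have hbound := intervalIntegral.norm_integral_le_of_norm_le (μ := MeasureTheory.volume)
    (zero_le_one' ℝ) (Filter.Eventually.of_forall hpt)
    (intervalIntegrable_const.add (hi2.const_mul (c * n)))
  rw [intervalIntegral.integral_sub hGi hi1, hI1, intervalIntegral.integral_add
    intervalIntegrable_const (hi2.const_mul (c * n)), intervalIntegral.integral_const_mul,
    intervalIntegral.integral_const, Real.norm_eq_abs] at hbound
  simp only [sub_zero, smul_eq_mul, one_mul] at hbound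
  have hl0 : 0 ≤ Real.log (1 + e) := Real.log_nonneg (by linarith)
  have hl1 : Real.log (1 + e) ≤ 1 := by
    have := Real.log_le_sub_one_of_pos (by linarith : 0 < 1 + e)
    linarith
  have hm1 : c * n * ∫ y in (0:ℝ)..1, e / (y + e) ^ 2 ≤ c * n * 1 :=
    mul_le_mul_of_nonneg_left hI2 (by positivity)
  have hm2 : c * Real.log (1 + e) ≤ c * 1 := mul_le_mul_of_nonneg_left hl1 hc0.le
  have hm3 : 0 ≤ c * Real.log (1 + e) := by positivity
  rw [abs_le] at hbound ⊢
  constructor <;> linarith [hbound.1, hbound.2]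
end
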